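/- arXiv:2402.17031 — 5 statements merged into one kernel-verified Lean document; each statement's English description precedes it below -/
import Mathlib

section
/- For every λ ∈ ℝ, β ≥ 0, γ > 1, α₀, α₁ > 0 and κ > 0 there exists a constant K = K(λ,β,γ,α₀,α₁,κ) > 0 with the following property: for every a : ℝ → [0,1] with √a κ-Lipschitz, every κ-Lipschitz V : ℝ → [0,1], every G ∈ 𝒢(α₀,α₁,γ), and every continuous viscosity solution u : ℝ → ℝ of a(x)u'' + G(u') + βV(x) = λ on ℝ, the function u is Lipschitz continuous on ℝ with constant K. -/
open Real Set MeasureTheory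

/-- The class 𝒢(α₀,α₁,γ): growth condition (G1) and local Lipschitz condition (G2). -/
def MemG (α₀ α₁ γ : ℝ) (G : ℝ → ℝ) : Prop :=
  (∀ p : ℝ, α₀ * |p| ^ γ - 1 / α₀ ≤ G p ∧ G p ≤ α₁ * (|p| ^ γ + 1)) ∧
  (∀ p q : ℝ, |G p - G q| ≤ α₁ * (|p| + |q| + 1) ^ (γ - 1) * |p - q|)

/-- Viscosity subsolution of a(x)u'' + G(u') + βV(x) = λ on ℝ. -/
def IsViscSubsol (a V G : ℝ → ℝ) (β lam : ℝ) (u : ℝ → ℝ) : Prop :=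
  ∀ x₀ : ℝ, ∀ φ : ℝ → ℝ, ContDiff ℝ 2 φ →
    IsLocalMax (fun x => u x - φ x) x₀ →
    lam ≤ a x₀ * deriv (deriv φ) x₀ + G (deriv φ x₀) + β * V x₀

/-- Viscosity supersolution of a(x)u'' + G(u') + βV(x) = λ on ℝ. -/
def IsViscSupersol (a V G : ℝ → ℝ) (β lam : ℝ) (u : ℝ → ℝ) : Prop :=
  ∀ x₀ : ℝ, ∀ φ : ℝ → ℝ, ContDiff ℝ 2 φ →
    IsLocalMin (fun x => u x - φ x) x₀ →
    a x₀ * deriv (deriv φ) x₀ + G (deriv φ x₀) + β * V x₀ ≤ lam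

/-- Continuous viscosity solution of a(x)u'' + G(u') + βV(x) = λ on ℝ. -/
def IsViscSol (a V G : ℝ → ℝ) (β lam : ℝ) (u : ℝ → ℝ) : Prop :=
  Continuous u ∧ IsViscSubsol a V G β lam u ∧ IsViscSupersol a V G β lam u

/-- A supersolution of `min (u'') 0 + α |u'| ^ γ ≤ C`, tested only with concave parabolas. -/
def ParabolicSupersol (α γ C : ℝ) (u : ℝ → ℝ) : Prop :=
  ∀ x b M : ℝ, 0 ≤ M → IsLocalMin (fun t => u t - (b * t - M * t ^ 2 / 2)) x →
    α * |b - M * x| ^ γ ≤ C + M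

/-- All slopes of `u` to the left of `x` are at least `p`. -/
def SlopesGeOnIic (u : ℝ → ℝ) (p x : ℝ) : Prop :=
  ∀ z z', z ≤ z' → z' ≤ x → p * (z' - z) ≤ u z' - u z

theorem IsViscSupersol.parabolicSupersol {a V G u : ℝ → ℝ} {lam β γ α₀ α₁ : ℝ}
    (hβ : 0 ≤ β) (ha : ∀ x, a x ∈ Set.Icc (0 : ℝ) 1) (hV : ∀ x, V x ∈ Set.Icc (0 : ℝ) 1)
    (hG : MemG α₀ α₁ γ G) (hu : IsViscSupersol a V G β lam u) :
    ParabolicSupersol α₀ γ (lam + 1 / α₀) u := by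
  intro x b M hM hmin
  have hd : deriv (fun t : ℝ => b * t - M * t ^ 2 / 2) = fun t => b - M * t := by
    funext t
    have h : HasDerivAt (fun t : ℝ => b * t - M * t ^ 2 / 2)
        (b * 1 - M * ((2 : ℕ) * t ^ (2 - 1)) / 2) t :=
      ((hasDerivAt_id t).const_mul b).sub (((hasDerivAt_pow 2 t).const_mul M).div_const 2)
    rw [h.deriv]
    norm_num
    ring
  have hd2 : deriv (fun t : ℝ => b - M * t) x = -M := by
    have h : HasDerivAt (fun t : ℝ => b - M * t) (-(M * 1)) x :=
      ((hasDerivAt_id x).const_mul M).const_sub b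
    rw [h.deriv, mul_one]
  have h := hu x (fun t => b * t - M * t ^ 2 / 2) (by fun_prop) hmin
  rw [hd, hd2] at h
  have hG1 := (hG.1 (b - M * x)).1
  have hβV := mul_nonneg hβ (hV x).1
  have haM := mul_le_mul_of_nonneg_right (ha x).2 hM
  dsimp only at h
  linarith

theorem ParabolicSupersol.comp_neg {α γ C : ℝ} {u : ℝ → ℝ} (hu : ParabolicSupersol α γ C u) :
    ParabolicSupersol α γ C (fun t => u (-t)) := by
  intro x b M hM hmin
  have hmin' : IsLocalMin (fun t => u t - (-b * t - M * t ^ 2 / 2)) (-x) := by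
    have ht : Filter.Tendsto (fun t : ℝ => -t) (nhds (-x)) (nhds x) := by
      simpa using (continuous_neg.tendsto (-x))
    filter_upwards [ht.eventually hmin] with t ht
    simpa using ht
  have h := hu (-x) (-b) M hM hmin'
  rwa [show -b - M * -x = -(b - M * x) by ring, abs_neg] at h

/-- A continuous function without local minima left of `y` that is smaller at `x < y` than at `y`
is monotone left of `x`. -/
theorem monotoneOn_Iic_of_forall_not_isLocalMin {v : ℝ → ℝ} (hv : Continuous v) {x y : ℝ}
    (hxy : x < y) (hlt : v x < v y) (hmin : ∀ m < y, ¬ IsLocalMin v m) :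
    MonotoneOn v (Set.Iic x) := by
  intro z _ z' hz' hzz'
  by_contra! hcon
  have hz'x : z' ≤ x := hz'
  obtain ⟨m, hm, hmm⟩ := isCompact_Icc.exists_isMinOn
    (⟨z, le_rfl, by linarith⟩ : (Set.Icc z y).Nonempty) hv.continuousOn
  have h1 : v m ≤ v z' := hmm ⟨hzz', by linarith⟩
  have h2 : v m ≤ v x := hmm ⟨by linarith, hxy.le⟩
  have hzm : z < m := lt_of_le_of_ne hm.1 (by rintro rfl; linarith)
  have hmy : m < y := lt_of_le_of_ne hm.2 (by rintro rfl; linarith)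
  exact hmin m hmy (hmm.isLocalMin (Icc_mem_nhds hzm hmy))

/-- Comparison with the parabola of slope `p` at `y` and second derivative `-M`. -/
theorem ParabolicSupersol.le_sub_of_lt {α γ C : ℝ} {u : ℝ → ℝ} (hu : ParabolicSupersol α γ C u)
    (hc : Continuous u) (hα : 0 < α) (hγ : 1 < γ) {p M x y : ℝ} (hp : 0 ≤ p) (hM : 0 ≤ M)
    (hpM : C + M < α * p ^ γ) (hxy : x < y)
    (hlt : p * (y - x) + M * (y - x) ^ 2 / 2 < u y - u x) {z z' : ℝ} (hzz' : z ≤ z')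
    (hz' : z' ≤ x) :
    (p + M * (y - z')) * (z' - z) ≤ u z' - u z := by
  have hmono : MonotoneOn (fun t => u t - ((p + M * y) * t - M * t ^ 2 / 2)) (Set.Iic x) := by
    refine monotoneOn_Iic_of_forall_not_isLocalMin (by fun_prop) hxy ?_ ?_
    · nlinarith
    · intro m hm hmin
      have h := hu m (p + M * y) M hM hmin
      have hle : p ≤ |p + M * y - M * m| := by
        refine le_trans ?_ (le_abs_self _)
        nlinarith [mul_nonneg hM (sub_nonneg.2 hm.le)]
      have h' := mul_le_mul_of_nonneg_left
        (Real.rpow_le_rpow hp hle (by linarith : (0 : ℝ) ≤ γ)) hα.le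
      linarith
  have h := hmono (show z ∈ Set.Iic x from hzz'.trans hz') hz' hzz'
  dsimp only at h
  nlinarith [mul_nonneg hM (sq_nonneg (z' - z))]

theorem lt_half_mul_rpow {α γ C p : ℝ} (hα : 0 < α) (hγ : 1 < γ) (hp : 1 + 2 * |C| / α ≤ p) :
    C < α * p ^ γ / 2 := by
  have h0 : 0 ≤ 2 * |C| / α := by positivity
  have h1 : p ≤ p ^ γ := Real.self_le_rpow_of_one_le (by linarith) hγ.le
  have h2 : α * (1 + 2 * |C| / α) ≤ α * p ^ γ :=
    mul_le_mul_of_nonneg_left (hp.trans h1) hα.le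
  have h3 : α * (1 + 2 * |C| / α) = α + 2 * |C| := by field_simp
  linarith [le_abs_self C]

/-- The slope lower bound doubles after moving left by a multiple of `p ^ (1 - γ)`. -/
theorem ParabolicSupersol.slopesGeOnIic_double {α γ C : ℝ} {u : ℝ → ℝ}
    (hu : ParabolicSupersol α γ C u) (hc : Continuous u) (hα : 0 < α) (hγ : 1 < γ) {p x : ℝ}
    (hp : 1 + 2 * |C| / α ≤ p) (hs : SlopesGeOnIic u (2 * p) x) :
    SlopesGeOnIic u (2 * (2 * p)) (x - 6 / α * p ^ (1 - γ)) := by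
  have hp0 : 0 < p := lt_of_lt_of_le (by positivity) hp
  have hC := lt_half_mul_rpow hα hγ hp
  set M := α * p ^ γ / 2 with hMdef
  have hM : 0 < M := by positivity
  have hd : 6 / α * p ^ (1 - γ) = 3 * (p / M) := by
    rw [Real.rpow_sub hp0, Real.rpow_one, hMdef]
    field_simp
    norm_num
  have he : 0 < p / M := by positivity
  have hMe : M * (p / M) = p := by field_simp
  rw [hd]
  intro z z' hzz' hz'
  have hslope : 2 * p * (x - (x - p / M)) ≤ u x - u (x - p / M) :=
    hs (x - p / M) x (by linarith) le_rfl
  have h := hu.le_sub_of_lt hc hα hγ (p := p) (M := M) (x := x - p / M) (y := x) hp0.le hM.le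
    (by linarith) (by linarith) (by nlinarith [mul_pos hp0 he]) hzz' (by linarith)
  refine le_trans (mul_le_mul_of_nonneg_right ?_ (by linarith)) h
  nlinarith [mul_le_mul_of_nonneg_left (show 3 * (p / M) ≤ x - z' by linarith) hM.le]

theorem SlopesGeOnIic.mono_right {u : ℝ → ℝ} {p x x' : ℝ} (h : SlopesGeOnIic u p x)
    (hx : x' ≤ x) : SlopesGeOnIic u p x' :=
  fun z z' hzz' hz' => h z z' hzz' (hz'.trans hx)

theorem ParabolicSupersol.not_slopesGeOnIic {α γ C : ℝ} {u : ℝ → ℝ}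
    (hu : ParabolicSupersol α γ C u) (hc : Continuous u) (hα : 0 < α) (hγ : 1 < γ) {p x : ℝ}
    (hp : 1 + 2 * |C| / α ≤ p) : ¬ SlopesGeOnIic u (2 * p) x := by
  intro hs
  have hp1 : 1 ≤ p := le_trans (le_add_of_nonneg_right (by positivity)) hp
  have hp0 : 0 < p := by linarith
  set r : ℝ := 2 ^ (1 - γ) with hr
  have hr0 : 0 < r := by positivity
  have hr1 : r < 1 := Real.rpow_lt_one_of_one_lt_of_neg (by norm_num) (by linarith)
  set d : ℝ := 6 / α * p ^ (1 - γ) with hd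
  have hd0 : 0 < d := by positivity
  have hiter : ∀ k : ℕ,
      SlopesGeOnIic u (2 * (2 ^ k * p)) (x - d * ∑ j ∈ Finset.range k, r ^ j) := by
    intro k
    induction k with
    | zero => simpa using hs
    | succ k ih =>
      have h2k : (1 : ℝ) ≤ 2 ^ k := one_le_pow₀ (by norm_num)
      have h := hu.slopesGeOnIic_double hc hα hγ (hp.trans (le_mul_of_one_le_left hp0.le h2k)) ih
      have hpow : ((2 : ℝ) ^ k * p) ^ (1 - γ) = r ^ k * p ^ (1 - γ) := by
        rw [Real.mul_rpow (by positivity) hp0.le, ← Real.rpow_natCast, ← Real.rpow_mul (by norm_num),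
          mul_comm (k : ℝ), Real.rpow_mul (by norm_num), Real.rpow_natCast]
      rw [hpow] at h
      convert h using 1
      · ring
      · rw [Finset.sum_range_succ, hd]
        ring
  have hsum : ∀ k : ℕ, ∑ j ∈ Finset.range k, r ^ j ≤ (1 - r)⁻¹ := fun k => by
    rw [← tsum_geometric_of_lt_one hr0.le hr1]
    exact (summable_geometric_of_lt_one hr0.le hr1).sum_le_tsum _ fun j _ => by positivity
  set X := x - d * (1 - r)⁻¹
  obtain ⟨k, hk⟩ := pow_unbounded_of_one_lt (u X - u (X - 1)) (one_lt_two (α := ℝ))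
  have hX : SlopesGeOnIic u (2 * (2 ^ k * p)) X :=
    (hiter k).mono_right (sub_le_sub_left (mul_le_mul_of_nonneg_left (hsum k) hd0.le) x)
  have h := hX (X - 1) X (by linarith) le_rfl
  have h2k : (0 : ℝ) < 2 ^ k := by positivity
  nlinarith

theorem ParabolicSupersol.sub_le {α γ C : ℝ} {u : ℝ → ℝ}
    (hu : ParabolicSupersol α γ C u) (hc : Continuous u) (hα : 0 < α) (hγ : 1 < γ) {x y : ℝ}
    (hxy : x ≤ y) : u y - u x ≤ 2 * (1 + 2 * |C| / α) * (y - x) := by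
  rcases hxy.eq_or_lt with rfl | hxy
  · simp
  by_contra! hcon
  set p := 1 + 2 * |C| / α with hp
  have hp0 : 0 < p := by positivity
  refine hu.not_slopesGeOnIic hc hα hγ (x := x) hp.ge fun z z' hzz' hz' => ?_
  have hC := lt_half_mul_rpow (p := 2 * p) hα hγ (by linarith)
  have hpos : 0 < α * (2 * p) ^ γ := by positivity
  have hC2 : C + 0 < α * (2 * p) ^ γ := by linarith
  simpa using hu.le_sub_of_lt hc hα hγ (p := 2 * p) (M := 0) (by positivity) le_rfl hC2 hxy
    (by simpa using hcon) hzz' hz'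

theorem ParabolicSupersol.lipschitzWith {α γ C : ℝ} {u : ℝ → ℝ}
    (hu : ParabolicSupersol α γ C u) (hc : Continuous u) (hα : 0 < α) (hγ : 1 < γ) :
    LipschitzWith (Real.toNNReal (2 * (1 + 2 * |C| / α))) u := by
  have hK : 0 ≤ 2 * (1 + 2 * |C| / α) := by positivity
  have key : ∀ x y, x ≤ y → |u x - u y| ≤ 2 * (1 + 2 * |C| / α) * |x - y| := by
    intro x y hxy
    have h1 := hu.sub_le hc hα hγ hxy
    have h2 := hu.comp_neg.sub_le (by fun_prop) hα hγ (neg_le_neg hxy)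
    simp only [neg_neg] at h2
    rw [abs_sub_comm x y, abs_of_nonneg (sub_nonneg.2 hxy), abs_le]
    constructor <;> linarith
  refine LipschitzWith.of_dist_le_mul fun x y => ?_
  rw [Real.coe_toNNReal _ hK, Real.dist_eq, Real.dist_eq]
  rcases le_total x y with h | h
  · exact key x y h
  · rw [abs_sub_comm (u x), abs_sub_comm x]
    exact key y x h

theorem lipschitz_bound_for_viscosity_solutions
    (lam β γ α₀ α₁ κ : ℝ)
    (hβ : 0 ≤ β) (hγ : 1 < γ) (hα₀ : 0 < α₀) (hα₁ : 0 < α₁) (hκ : 0 < κ) :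
    ∃ K : ℝ, 0 < K ∧
      ∀ (a V G : ℝ → ℝ) (u : ℝ → ℝ),
        (∀ x, a x ∈ Set.Icc (0 : ℝ) 1) →
        LipschitzWith (Real.toNNReal κ) (fun x => Real.sqrt (a x)) →
        (∀ x, V x ∈ Set.Icc (0 : ℝ) 1) →
        LipschitzWith (Real.toNNReal κ) V →
        MemG α₀ α₁ γ G →
        IsViscSol a V G β lam u →
        LipschitzWith (Real.toNNReal K) u := by
  refine ⟨2 * (1 + 2 * |lam + 1 / α₀| / α₀), by positivity, ?_⟩
  intro a V G u ha _ hV _ hG hu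
  exact (hu.2.2.parabolicSupersol hβ ha hV hG).lipschitzWith hu.1 hα₀ hγ
end

section
/- Let λ ∈ ℝ, β ≥ 0, let a : ℝ → [0,1] with √a κ-Lipschitz, V : ℝ → [0,1] κ-Lipschitz, G ∈ 𝒢(α₀,α₁,γ), and let u : ℝ → ℝ be a continuous viscosity solution of a(x)u'' + G(u') + βV(x) = λ on ℝ. Then u is of class C² on every open interval I on which a is strictly positive, and on every such interval u satisfies a(x)u''(x) + G(u'(x)) + βV(x) = λ pointwise. -/
open Real Set MeasureTheory

/-- If every `C²` function touching `u` from below has second derivative at most that of `w`, then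
`u - w` is concave. -/
theorem concaveOn_sub_of_isLocalMin_imp {S : Set ℝ} (hS : Convex ℝ S) {u w : ℝ → ℝ}
    (hu : Continuous u) (hw : ContDiff ℝ 2 w)
    (H : ∀ t ∈ S, ∀ φ : ℝ → ℝ, ContDiff ℝ 2 φ → IsLocalMin (fun x => u x - φ x) t →
      deriv (deriv φ) t ≤ deriv (deriv w) t) :
    ConcaveOn ℝ S (fun x => u x - w x) := by
  refine concaveOn_of_slope_anti_adjacent hS ?_
  intro x y z hx hz hxy hyz
  by_contra! hlt
  obtain ⟨v, hv⟩ : ∃ v : ℝ → ℝ, v = fun s => u s - w s := ⟨_, rfl⟩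
  have hvs (s : ℝ) : u s - w s = v s := by rw [hv]
  rw [hvs, hvs, hvs] at hlt
  have hvc : Continuous v := by rw [hv]; exact hu.sub hw.continuous
  have hxy' : 0 < y - x := sub_pos.2 hxy
  have hyz' : 0 < z - y := sub_pos.2 hyz
  have hxz' : 0 < z - x := by linarith
  obtain ⟨m, hm⟩ : ∃ m, m * (z - x) = v z - v x := ⟨(v z - v x) / (z - x), by field_simp⟩
  have hD : 0 < v x + m * (y - x) - v y := by
    rw [div_lt_div_iff₀ hxy' hyz'] at hlt
    refine pos_of_mul_pos_left ?_ hxz'.le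
    linear_combination hlt - (y - x) * hm
  obtain ⟨ε, hε⟩ : ∃ ε, ε * (2 * ((y - x) * (z - y))) = v x + m * (y - x) - v y :=
    ⟨(v x + m * (y - x) - v y) / (2 * ((y - x) * (z - y))), by field_simp⟩
  have hε0 : 0 < ε := pos_of_mul_pos_left (hε ▸ hD) (by positivity)
  obtain ⟨q, hq⟩ : ∃ q : ℝ → ℝ, q = fun s => v x + m * (s - x) + ε * ((s - x) * (s - z)) :=
    ⟨_, rfl⟩
  have hq2 : ContDiff ℝ 2 q := by rw [hq]; fun_prop
  have hq' : deriv q = fun s => m + ε * ((s - z) + (s - x)) := by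
    ext s
    rw [hq]
    have h1 := (hasDerivAt_id s).sub_const x
    have h2 := (hasDerivAt_id s).sub_const z
    have h3 := ((h1.const_mul m).const_add (v x)).add ((h1.mul h2).const_mul ε)
    refine (h3.congr_deriv ?_).deriv
    simp
  have hq'' (t : ℝ) : deriv (deriv q) t = 2 * ε := by
    rw [hq']
    have h1 := (hasDerivAt_id t).sub_const x
    have h2 := (hasDerivAt_id t).sub_const z
    refine ((((h2.add h1).const_mul ε).const_add m).congr_deriv ?_).deriv
    ring
  obtain ⟨t, ht, htmin⟩ := isCompact_Icc.exists_isMinOn (nonempty_Icc.2 (hxy.trans hyz).le)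
    ((hvc.sub hq2.continuous).continuousOn (s := Icc x z))
  have hty : v t - q t < 0 := by
    refine (htmin ⟨hxy.le, hyz.le⟩ : v t - q t ≤ v y - q y).trans_lt ?_
    change v y - q y < 0
    rw [hq]
    linarith
  have htx : t ≠ x := by
    rintro rfl
    simp [hq] at hty
  have htz : t ≠ z := by
    rintro rfl
    simp only [hq, sub_self, mul_zero, add_zero, hm] at hty
    linarith
  have htI : t ∈ Ioo x z := ⟨lt_of_le_of_ne ht.1 htx.symm, lt_of_le_of_ne ht.2 htz⟩
  have htS : t ∈ S := hS.ordConnected.out hx hz ht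
  have hmin : IsLocalMin (fun s => u s - (w + q) s) t := by
    have := htmin.isLocalMin (Icc_mem_nhds htI.1 htI.2)
    refine this.congr (.of_forall fun s => ?_)
    simp only [Pi.add_apply, Pi.sub_apply, hv]
    ring
  have key := H t htS (w + q) (hw.add hq2) hmin
  have hd : deriv (w + q) = deriv w + deriv q := by
    ext s
    exact deriv_add (hw.differentiable two_ne_zero s) (hq2.differentiable two_ne_zero s)
  have hw1 : Differentiable ℝ (deriv w) :=
    (contDiff_succ_iff_deriv (n := 1).1 hw).2.2.differentiable one_ne_zero
  have hq1 : Differentiable ℝ (deriv q) :=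
    (contDiff_succ_iff_deriv (n := 1).1 hq2).2.2.differentiable one_ne_zero
  rw [hd, deriv_add (hw1 t) (hq1 t), hq''] at key
  linarith

/-- If every `C²` function touching `u` from above has second derivative at least that of `w`, then
`u - w` is convex. -/
theorem convexOn_sub_of_isLocalMax_imp {S : Set ℝ} (hS : Convex ℝ S) {u w : ℝ → ℝ}
    (hu : Continuous u) (hw : ContDiff ℝ 2 w)
    (H : ∀ t ∈ S, ∀ φ : ℝ → ℝ, ContDiff ℝ 2 φ → IsLocalMax (fun x => u x - φ x) t →
      deriv (deriv w) t ≤ deriv (deriv φ) t) :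
    ConvexOn ℝ S (fun x => u x - w x) := by
  have hneg (f : ℝ → ℝ) : deriv (deriv (-f)) = -deriv (deriv f) := by
    rw [show deriv (-f) = -deriv f from funext fun _ => deriv.neg]
    exact funext fun _ => deriv.neg
  have h := concaveOn_sub_of_isLocalMin_imp hS (u := -u) (w := -w) hu.neg hw.neg
    fun t ht φ hφ hmin => by
      have hmax : IsLocalMax (fun x => u x - (-φ) x) t := by
        refine hmin.neg.congr (.of_forall fun s => ?_)
        simp only [Pi.neg_apply]
        ring
      have := H t ht (-φ) hφ.neg hmax
      rw [hneg] at this ⊢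
      simp only [Pi.neg_apply] at this ⊢
      linarith
  refine h.neg.congr fun s _ => ?_
  simp only [Pi.neg_apply]
  ring

/-- A function that is concave up to one differentiable function and convex up to another one is
differentiable in the interior. -/
theorem differentiableAt_of_concaveOn_sub_of_convexOn_sub {S : Set ℝ} {u w₁ w₂ : ℝ → ℝ} {x : ℝ}
    (hx : x ∈ interior S) (hw₁ : DifferentiableAt ℝ w₁ x) (hw₂ : DifferentiableAt ℝ w₂ x)
    (h₁ : ConcaveOn ℝ S (fun x => u x - w₁ x)) (h₂ : ConvexOn ℝ S (fun x => u x - w₂ x)) :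
    DifferentiableAt ℝ u x := by
  have hr := (h₂.hasDerivWithinAt_rightDeriv_of_mem_interior hx)
  have hl := (h₂.hasDerivWithinAt_leftDeriv_of_mem_interior hx)
  have hle := h₂.leftDeriv_le_rightDeriv_of_mem_interior hx
  have hle' := h₁.neg.leftDeriv_le_rightDeriv_of_mem_interior hx
  set r := derivWithin (fun x => u x - w₂ x) (Ioi x) x
  set l := derivWithin (fun x => u x - w₂ x) (Iio x) x
  have hwr (s : Set ℝ) := (hw₂.hasDerivAt.sub hw₁.hasDerivAt).hasDerivWithinAt (s := s)
  have hneg : -(fun x => u x - w₁ x) = -((fun x => u x - w₂ x) + (w₂ - w₁)) := by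
    ext s
    simp
  rw [hneg, (hl.add (hwr _)).neg.derivWithin (uniqueDiffWithinAt_Iio x),
    (hr.add (hwr _)).neg.derivWithin (uniqueDiffWithinAt_Ioi x)] at hle'
  have hlr : l = r := by linarith
  rw [hlr] at hl
  have h := (hl.union hr)
  rw [Iio_union_Ioi, compl_eq_univ_sdiff, hasDerivWithinAt_sdiff_singleton,
    hasDerivWithinAt_univ] at h
  have h' := h.add hw₂.hasDerivAt
  exact (h'.congr_of_eventuallyEq (.of_forall fun s => by simp)).differentiableAt

/-- The increments of the derivative of a function that is concave up to `w₁` and convex up to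
`w₂` lie between those of the derivatives of `w₂` and `w₁`. -/
theorem deriv_sub_deriv_mem_Icc {S : Set ℝ} {u w₁ w₂ : ℝ → ℝ}
    (hu : ∀ x ∈ S, DifferentiableAt ℝ u x) (hw₁ : Differentiable ℝ w₁) (hw₂ : Differentiable ℝ w₂)
    (h₁ : ConcaveOn ℝ S (fun x => u x - w₁ x)) (h₂ : ConvexOn ℝ S (fun x => u x - w₂ x))
    {x y : ℝ} (hx : x ∈ S) (hy : y ∈ S) (hxy : x ≤ y) :
    deriv u y - deriv u x ∈ Icc (deriv w₂ y - deriv w₂ x) (deriv w₁ y - deriv w₁ x) := by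
  have a₁ := h₁.antitoneOn_deriv (fun s hs => (hu s hs).sub (hw₁ s)) hx hy hxy
  have a₂ := h₂.monotoneOn_deriv (fun s hs => (hu s hs).sub (hw₂ s)) hx hy hxy
  rw [deriv_fun_sub (hu x hx) (hw₁ x), deriv_fun_sub (hu y hy) (hw₁ y)] at a₁
  rw [deriv_fun_sub (hu x hx) (hw₂ x), deriv_fun_sub (hu y hy) (hw₂ y)] at a₂
  constructor <;> linarith

theorem continuousOn_deriv_of_concaveOn_sub_of_convexOn_sub {S : Set ℝ} {u w₁ w₂ : ℝ → ℝ}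
    (hu : ∀ x ∈ S, DifferentiableAt ℝ u x) (hw₁ : ContDiff ℝ 2 w₁) (hw₂ : ContDiff ℝ 2 w₂)
    (h₁ : ConcaveOn ℝ S (fun x => u x - w₁ x)) (h₂ : ConvexOn ℝ S (fun x => u x - w₂ x)) :
    ContinuousOn (deriv u) S := by
  intro x hx
  have hinc {s t : ℝ} (hs : s ∈ S) (ht : t ∈ S) (hst : s ≤ t) :=
    deriv_sub_deriv_mem_Icc hu (hw₁.differentiable two_ne_zero) (hw₂.differentiable two_ne_zero)
      h₁ h₂ hs ht hst
  have hbound : ∀ y ∈ S, dist (deriv u y) (deriv u x) ≤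
      |deriv w₁ y - deriv w₁ x| + |deriv w₂ y - deriv w₂ x| := by
    intro y hy
    rw [Real.dist_eq]
    rcases le_total x y with h | h
    · obtain ⟨b₁, b₂⟩ := hinc hx hy h
      have := le_abs_self (deriv w₁ y - deriv w₁ x)
      have := neg_abs_le (deriv w₂ y - deriv w₂ x)
      exact abs_le.2 ⟨by linarith [abs_nonneg (deriv w₁ y - deriv w₁ x)],
        by linarith [abs_nonneg (deriv w₂ y - deriv w₂ x)]⟩
    · obtain ⟨b₁, b₂⟩ := hinc hy hx h
      have := neg_abs_le (deriv w₁ y - deriv w₁ x)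
      have := le_abs_self (deriv w₂ y - deriv w₂ x)
      exact abs_le.2 ⟨by linarith [abs_nonneg (deriv w₂ y - deriv w₂ x)],
        by linarith [abs_nonneg (deriv w₁ y - deriv w₁ x)]⟩
  have hc : Continuous fun y => |deriv w₁ y - deriv w₁ x| + |deriv w₂ y - deriv w₂ x| := by
    have := hw₁.continuous_deriv one_le_two
    have := hw₂.continuous_deriv one_le_two
    fun_prop
  have h0 := hc.tendsto x
  simp only [sub_self, abs_zero, add_zero] at h0
  exact tendsto_iff_dist_tendsto_zero.2 (squeeze_zero' (.of_forall fun _ => dist_nonneg)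
    (Filter.eventually_of_mem self_mem_nhdsWithin hbound) (h0.mono_left nhdsWithin_le_nhds))

/-- A function touching an `L`-Lipschitz function from above has slope at most `L` there. -/
theorem abs_deriv_le_of_isLocalMax_sub {u φ : ℝ → ℝ} {t L : ℝ} {s : Set ℝ} (hs : s ∈ nhds t)
    (hL : ∀ x ∈ s, |u x - u t| ≤ L * |x - t|) (hφ : DifferentiableAt ℝ φ t)
    (hmax : IsLocalMax (fun x => u x - φ x) t) : |deriv φ t| ≤ L := by
  have hsl := hasDerivAt_iff_tendsto_slope.1 hφ.hasDerivAt
  have hev : ∀ᶠ x in nhds t, -(L * |x - t|) ≤ φ x - φ t := by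
    filter_upwards [hs, hmax] with x hx hx'
    have := (abs_le.1 (hL x hx)).1
    linarith
  rw [abs_le]
  constructor
  · refine ge_of_tendsto (hsl.mono_left (nhdsWithin_mono t (t := {t}ᶜ) (s := Ioi t)
      fun x hx => ne_of_gt hx)) ?_
    filter_upwards [self_mem_nhdsWithin, nhdsWithin_le_nhds hev] with x hx h
    have hx' : 0 < x - t := sub_pos.2 hx
    rw [slope_def_field, le_div_iff₀ hx']
    rw [abs_of_pos hx'] at h
    linarith
  · refine le_of_tendsto (hsl.mono_left (nhdsWithin_mono t (t := {t}ᶜ) (s := Iio t)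
      fun x hx => ne_of_lt hx)) ?_
    filter_upwards [self_mem_nhdsWithin, nhdsWithin_le_nhds hev] with x hx h
    have hx' : x - t < 0 := sub_neg.2 hx
    rw [slope_def_field, div_le_iff_of_neg hx']
    rw [abs_of_neg hx'] at h
    linarith

theorem exists_contDiff_two_deriv_deriv_eq {F : ℝ → ℝ} (hF : Continuous F) :
    ∃ w : ℝ → ℝ, ContDiff ℝ 2 w ∧ deriv (deriv w) = F := by
  have prim {f : ℝ → ℝ} (hf : Continuous f) (x : ℝ) :
      HasDerivAt (fun x => ∫ s in (0 : ℝ)..x, f s) (f x) x :=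
    (hf.integral_hasStrictDerivAt 0 x).hasDerivAt
  obtain ⟨g, hg⟩ : ∃ g : ℝ → ℝ, ∀ x, HasDerivAt g (F x) x := ⟨_, prim hF⟩
  have hg' : deriv g = F := funext fun x => (hg x).deriv
  have hgd : Differentiable ℝ g := fun x => (hg x).differentiableAt
  obtain ⟨w, hw⟩ : ∃ w : ℝ → ℝ, ∀ x, HasDerivAt w (g x) x := ⟨_, prim hgd.continuous⟩
  have hw' : deriv w = g := funext fun x => (hw x).deriv
  refine ⟨w, ?_, by rw [hw', hg']⟩
  refine (contDiff_succ_iff_deriv (n := 1)).2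
    ⟨fun x => (hw x).differentiableAt, by simp, ?_⟩
  rw [hw', contDiff_one_iff_deriv, hg']
  exact ⟨hgd, hF⟩

theorem MemG.continuous {α₀ α₁ γ : ℝ} {G : ℝ → ℝ} (hγ : 1 < γ) (hG : MemG α₀ α₁ γ G) :
    Continuous G := by
  refine continuous_iff_continuousAt.2 fun p => ?_
  have hc : Continuous fun q => α₁ * (|q| + |p| + 1) ^ (γ - 1) * |q - p| := by
    have : Continuous fun q : ℝ => (|q| + |p| + 1) ^ (γ - 1) :=
      Continuous.rpow_const (by fun_prop) fun _ => Or.inr (by linarith)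
    fun_prop
  have h0 := hc.tendsto p
  simp only [sub_self, abs_zero, mul_zero] at h0
  exact tendsto_iff_dist_tendsto_zero.2 (squeeze_zero (fun _ => dist_nonneg)
    (fun q => hG.2 q p) h0)

theorem deriv_deriv_const_mul_sq (K : ℝ) :
    deriv (deriv fun x : ℝ => K / 2 * x ^ 2) = fun _ => K := by
  have h (x : ℝ) : HasDerivAt (fun x : ℝ => K / 2 * x ^ 2) (K * x) x :=
    ((hasDerivAt_pow 2 x).const_mul (K / 2)).congr_deriv (by norm_num; ring)
  rw [show (deriv fun x : ℝ => K / 2 * x ^ 2) = fun x => K * x from funext fun x => (h x).deriv]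
  ext x
  exact (((hasDerivAt_id x).const_mul K).congr_deriv (mul_one K)).deriv

section Regularity

variable {a V G u : ℝ → ℝ} {lam β γ α₀ α₁ δ : ℝ} {S : Set ℝ}

/-- Where `a ≥ δ > 0`, coercivity of `G` makes supersolutions semiconcave. -/
theorem IsViscSupersol.concaveOn_sub_sq (hα₀ : 0 < α₀) (hβ : 0 ≤ β) (hV : ∀ x, 0 ≤ V x)
    (hG : MemG α₀ α₁ γ G) (hu : Continuous u) (hsup : IsViscSupersol a V G β lam u)
    (hδ : 0 < δ) (hS : Convex ℝ S) (haS : ∀ x ∈ S, δ ≤ a x) :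
    ConcaveOn ℝ S (fun x => u x - (|lam| + 1 / α₀) / δ / 2 * x ^ 2) := by
  refine concaveOn_sub_of_isLocalMin_imp hS hu (by fun_prop) fun t ht φ hφ hmin => ?_
  rw [deriv_deriv_const_mul_sq]
  have h := hsup t φ hφ hmin
  have hGt := (hG.1 (deriv φ t)).1
  have hp : 0 ≤ α₀ * |deriv φ t| ^ γ := by positivity
  have hVt := mul_nonneg hβ (hV t)
  have hle : a t * deriv (deriv φ) t ≤ |lam| + 1 / α₀ := by linarith [le_abs_self lam]
  have hC : 0 ≤ |lam| + 1 / α₀ := by positivity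
  rw [le_div_iff₀ hδ]
  rcases le_total (deriv (deriv φ) t) 0 with h0 | h0
  · nlinarith
  · nlinarith [haS t ht]

/-- Where `a ≥ δ > 0`, Lipschitz subsolutions are semiconvex. -/
theorem IsViscSubsol.convexOn_sub_sq {L : ℝ} (hγ : 0 ≤ γ) (hα₁ : 0 ≤ α₁) (hβ : 0 ≤ β)
    (hV : ∀ x, V x ≤ 1)
    (hG : MemG α₀ α₁ γ G) (hu : Continuous u) (hsub : IsViscSubsol a V G β lam u)
    (hδ : 0 < δ) (hS : Convex ℝ S) (hSo : IsOpen S) (haS : ∀ x ∈ S, δ ≤ a x)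
    (hL : ∀ x ∈ S, ∀ y ∈ S, |u x - u y| ≤ L * |x - y|) :
    ConvexOn ℝ S (fun x => u x - -((|lam| + α₁ * (|L| ^ γ + 1) + β) / δ) / 2 * x ^ 2) := by
  refine convexOn_sub_of_isLocalMax_imp hS hu (by fun_prop) fun t ht φ hφ hmax => ?_
  rw [deriv_deriv_const_mul_sq]
  have h := hsub t φ hφ hmax
  have hslope := abs_deriv_le_of_isLocalMax_sub (hSo.mem_nhds ht) (fun x hx => hL x hx t ht)
    (hφ.differentiable two_ne_zero t) hmax
  have hGt := (hG.1 (deriv φ t)).2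
  have hp : α₁ * (|deriv φ t| ^ γ + 1) ≤ α₁ * (|L| ^ γ + 1) := by
    have := rpow_le_rpow (abs_nonneg _) (hslope.trans (le_abs_self L)) hγ
    gcongr
  have hVt := mul_le_mul_of_nonneg_left (hV t) hβ
  have hC : 0 ≤ |lam| + α₁ * (|L| ^ γ + 1) + β := by positivity
  have hle : -(|lam| + α₁ * (|L| ^ γ + 1) + β) ≤ a t * deriv (deriv φ) t := by
    linarith [neg_abs_le lam]
  rw [neg_le, le_div_iff₀ hδ]
  rcases le_total (deriv (deriv φ) t) 0 with h0 | h0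
  · nlinarith [haS t ht]
  · nlinarith

/-- A viscosity solution of class `C¹` near `x` has the second derivative prescribed by the
equation. -/
theorem IsViscSol.hasDerivAt_deriv (hu : IsViscSol a V G β lam u) (ha : Continuous a)
    (hV : Continuous V) (hG : Continuous G) (hSo : IsOpen S) (haS : ∀ x ∈ S, 0 < a x)
    (hud : ∀ x ∈ S, DifferentiableAt ℝ u x) (huc : ContinuousOn (deriv u) S) {x : ℝ}
    (hx : x ∈ S) :
    HasDerivAt (deriv u) ((lam - G (deriv u x) - β * V x) / a x) x := by
  set f : ℝ → ℝ := fun x => (lam - G (deriv u x) - β * V x) / a x with hf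
  have hfc : ContinuousOn f S :=
    ((continuousOn_const.sub (hG.comp_continuousOn huc)).sub
      (hV.continuousOn.const_smul β)).div ha.continuousOn fun x hx => (haS x hx).ne'
  obtain ⟨r, hr, hrS⟩ := Metric.nhds_basis_closedBall.mem_iff.1 (hSo.mem_nhds hx)
  rw [Real.closedBall_eq_Icc] at hrS
  have hle : x - r ≤ x + r := by linarith
  obtain ⟨w, hw, hw''⟩ := exists_contDiff_two_deriv_deriv_eq
    ((continuousOn_iff_continuous_domRestrict.1 (hfc.mono hrS)).Icc_extend' (h := hle))
  have hwf : ∀ t ∈ Ioo (x - r) (x + r), deriv (deriv w) t = f t := by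
    intro t ht
    rw [hw'', IccExtend_of_mem _ _ (Ioo_subset_Icc_self ht)]
    rfl
  have hsubS : Ioo (x - r) (x + r) ⊆ S := Ioo_subset_Icc_self.trans hrS
  have hderiv {t : ℝ} {φ : ℝ → ℝ} (ht : t ∈ S) (hφ : ContDiff ℝ 2 φ)
      (hext : IsLocalExtr (fun x => u x - φ x) t) : deriv φ t = deriv u t := by
    have h := hext.deriv_eq_zero
    rw [deriv_fun_sub (hud t ht) (hφ.differentiable two_ne_zero t)] at h
    linarith
  have hconc : ConcaveOn ℝ (Ioo (x - r) (x + r)) (fun x => u x - w x) := by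
    refine concaveOn_sub_of_isLocalMin_imp (convex_Ioo _ _) hu.1 hw fun t ht φ hφ hmin => ?_
    have h := hu.2.2 t φ hφ hmin
    rw [hderiv (hsubS ht) hφ (Or.inl hmin)] at h
    rw [hwf t ht, hf, le_div_iff₀ (haS t (hsubS ht))]
    linarith
  have hconv : ConvexOn ℝ (Ioo (x - r) (x + r)) (fun x => u x - w x) := by
    refine convexOn_sub_of_isLocalMax_imp (convex_Ioo _ _) hu.1 hw fun t ht φ hφ hmax => ?_
    have h := hu.2.1 t φ hφ hmax
    rw [hderiv (hsubS ht) hφ (Or.inr hmax)] at h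
    rw [hwf t ht, hf, div_le_iff₀ (haS t (hsubS ht))]
    linarith
  have hxI : x ∈ Ioo (x - r) (x + r) := ⟨by linarith, by linarith⟩
  have hwd := hw.differentiable two_ne_zero
  have hinc {s t : ℝ} (hs : s ∈ Ioo (x - r) (x + r)) (ht : t ∈ Ioo (x - r) (x + r))
      (hst : s ≤ t) :=
    deriv_sub_deriv_mem_Icc (fun y hy => hud y (hsubS hy)) hwd hwd hconc hconv hs ht hst
  have heq : ∀ y ∈ Ioo (x - r) (x + r), deriv u y = deriv w y + (deriv u x - deriv w x) := by
    intro y hy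
    rcases le_total x y with h | h
    · obtain ⟨b₁, b₂⟩ := hinc hxI hy h
      linarith
    · obtain ⟨b₁, b₂⟩ := hinc hy hxI h
      linarith
  have hw1 : Differentiable ℝ (deriv w) :=
    (contDiff_succ_iff_deriv (n := 1).1 hw).2.2.differentiable one_ne_zero
  have h := (hw1 x).hasDerivAt.add_const (deriv u x - deriv w x)
  rw [hwf x hxI] at h
  exact h.congr_of_eventuallyEq (Filter.eventually_of_mem (Ioo_mem_nhds hxI.1 hxI.2) heq)

/-- Viscosity solutions are `C¹` near every point at which `a` is positive. -/
theorem IsViscSol.exists_isOpen_C1 (hu : IsViscSol a V G β lam u) (ha : Continuous a)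
    (hγ : 0 ≤ γ) (hα₀ : 0 < α₀) (hα₁ : 0 ≤ α₁) (hβ : 0 ≤ β)
    (hV : ∀ x, V x ∈ Icc (0 : ℝ) 1) (hG : MemG α₀ α₁ γ G) {x : ℝ} (hx : 0 < a x) :
    ∃ S : Set ℝ, IsOpen S ∧ x ∈ S ∧ (∀ y ∈ S, 0 < a y) ∧ (∀ y ∈ S, DifferentiableAt ℝ u y) ∧
      ContinuousOn (deriv u) S := by
  have hδ : 0 < a x / 2 := half_pos hx
  obtain ⟨r, hr, hrS⟩ := Metric.nhds_basis_ball.mem_iff.1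
    (ha.continuousAt.eventually (lt_mem_nhds (half_lt_self hx)))
  have haB : ∀ y ∈ Metric.ball x r, a x / 2 ≤ a y := fun y hy => (hrS hy : a x / 2 < a y).le
  have hconc := hu.2.2.concaveOn_sub_sq hα₀ hβ (fun x => (hV x).1) hG hu.1 hδ
    (convex_ball x r) haB
  set K := (|lam| + 1 / α₀) / (a x / 2)
  have hlip : LocallyLipschitzOn (Metric.ball x r) u := by
    have h1 := hconc.locallyLipschitzOn Metric.isOpen_ball
    have h2 : LocallyLipschitz fun x : ℝ => K / 2 * x ^ 2 :=
      ContDiff.locallyLipschitz (𝕂 := ℝ) (by fun_prop)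
    simpa only [sub_add_cancel] using h1.add h2.locallyLipschitzOn
  obtain ⟨L, T, hT, hLT⟩ := hlip (Metric.mem_ball_self hr)
  rw [Metric.isOpen_ball.nhdsWithin_eq (Metric.mem_ball_self hr)] at hT
  obtain ⟨r', hr', hrT⟩ := Metric.nhds_basis_ball.mem_iff.1
    (Filter.inter_mem hT (Metric.ball_mem_nhds x hr))
  have hBB : Metric.ball x r' ⊆ Metric.ball x r := fun y hy => (hrT hy).2
  have hconv := hu.2.1.convexOn_sub_sq (L := L) hγ hα₁ hβ (fun x => (hV x).2) hG hu.1 hδ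
    (convex_ball x r') Metric.isOpen_ball (fun y hy => haB y (hBB hy))
    (fun y hy z hz => hLT.dist_le_mul y (hrT hy).1 z (hrT hz).1)
  have hconc' := hconc.subset hBB (convex_ball x r')
  have hd : ∀ y ∈ Metric.ball x r', DifferentiableAt ℝ u y := fun y hy =>
    differentiableAt_of_concaveOn_sub_of_convexOn_sub
      (by rwa [Metric.isOpen_ball.interior_eq]) (by fun_prop) (by fun_prop) hconc' hconv
  exact ⟨Metric.ball x r', Metric.isOpen_ball, Metric.mem_ball_self hr',
    fun y hy => hδ.trans_le (haB y (hBB hy)), hd,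
    continuousOn_deriv_of_concaveOn_sub_of_convexOn_sub hd (by fun_prop) (by fun_prop)
      hconc' hconv⟩

end Regularity

theorem viscosity_solution_C2_on_nondegenerate_intervals
    (lam β γ α₀ α₁ κ : ℝ)
    (hβ : 0 ≤ β) (hγ : 1 < γ) (hα₀ : 0 < α₀) (hα₁ : 0 < α₁) (hκ : 0 < κ)
    (a V G : ℝ → ℝ) (u : ℝ → ℝ)
    (ha_range : ∀ x, a x ∈ Set.Icc (0 : ℝ) 1)
    (ha_lip : LipschitzWith (Real.toNNReal κ) (fun x => Real.sqrt (a x)))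
    (hV_range : ∀ x, V x ∈ Set.Icc (0 : ℝ) 1)
    (hV_lip : LipschitzWith (Real.toNNReal κ) V)
    (hG : MemG α₀ α₁ γ G)
    (hu : IsViscSol a V G β lam u) :
    ∀ I : Set ℝ, IsOpen I → I.OrdConnected → (∀ x ∈ I, 0 < a x) →
      ContDiffOn ℝ 2 u I ∧
      ∀ x ∈ I, a x * deriv (deriv u) x + G (deriv u x) + β * V x = lam := by
  intro I hI _ haI
  have ha : Continuous a := by
    have h := ha_lip.continuous.pow 2
    refine h.congr fun x => ?_
    simp [Real.sq_sqrt (ha_range x).1]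
  have hGc := hG.continuous hγ
  have hloc (x : ℝ) (hx : x ∈ I) : DifferentiableAt ℝ u x ∧ ContinuousAt (deriv u) x ∧
      HasDerivAt (deriv u) ((lam - G (deriv u x) - β * V x) / a x) x := by
    obtain ⟨S, hSo, hxS, haS, hd, hc⟩ := hu.exists_isOpen_C1 ha (by linarith) hα₀ hα₁.le hβ
      hV_range hG (haI x hx)
    exact ⟨hd x hxS, hc.continuousAt (hSo.mem_nhds hxS),
      hu.hasDerivAt_deriv ha hV_lip.continuous hGc hSo haS hd hc hxS⟩
  have hVc := hV_lip.continuous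
  refine ⟨?_, fun x hx => ?_⟩
  · refine (contDiffOn_succ_iff_deriv_of_isOpen (n := 1) hI).2
      ⟨fun x hx => (hloc x hx).1.differentiableWithinAt, by simp, ?_⟩
    refine (contDiffOn_succ_iff_deriv_of_isOpen (n := 0) hI).2
      ⟨fun x hx => (hloc x hx).2.2.differentiableAt.differentiableWithinAt, by simp, ?_⟩
    rw [contDiffOn_zero]
    have huc : ContinuousOn (deriv u) I := fun x hx => (hloc x hx).2.1.continuousWithinAt
    refine ContinuousOn.congr (f := fun x => (lam - G (deriv u x) - β * V x) / a x) ?_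
      fun x hx => (hloc x hx).2.2.deriv
    exact ((continuousOn_const.sub (hGc.comp_continuousOn huc)).sub
      (hVc.const_smul β).continuousOn).div ha.continuousOn fun x hx => (haI x hx).ne'
  · rw [(hloc x hx).2.2.deriv, mul_div_cancel₀ _ (haI x hx).ne']
    ring
end

section
/- Let λ ∈ ℝ, β ≥ 0, let a : ℝ → [0,1] with √a κ-Lipschitz, V : ℝ → [0,1] continuous, and G : ℝ → ℝ continuous. Let u : ℝ → ℝ be a viscosity supersolution (respectively, subsolution) of a(x)u'' + G(u') + βV(x) = λ on ℝ. If u is differentiable at a point x₀ ∈ ℝ where a(x₀) = 0, then G(u'(x₀)) + βV(x₀) ≤ λ (respectively, G(u'(x₀)) + βV(x₀) ≥ λ). -/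
open Real Set MeasureTheory
/-- If `√a` is `κ`-Lipschitz and `a` vanishes at `x₀`, then `a` grows at most quadratically. -/
lemma le_sq_of_lipschitzWith_sqrt {a : ℝ → ℝ} {κ : ℝ} (hκ : 0 < κ) (ha : ∀ x, 0 ≤ a x)
    (ha_lip : LipschitzWith (Real.toNNReal κ) (fun x => Real.sqrt (a x)))
    {x₀ : ℝ} (ha₀ : a x₀ = 0) (x : ℝ) : a x ≤ κ ^ 2 * (x - x₀) ^ 2 := by
  have h := ha_lip.dist_le_mul x x₀
  simp only [Real.dist_eq, ha₀, Real.sqrt_zero, sub_zero, Real.coe_toNNReal κ hκ.le,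
    abs_of_nonneg (Real.sqrt_nonneg _)] at h
  calc a x = Real.sqrt (a x) ^ 2 := (Real.sq_sqrt (ha x)).symm
    _ ≤ (κ * |x - x₀|) ^ 2 := by gcongr
    _ = κ ^ 2 * (x - x₀) ^ 2 := by rw [mul_pow, sq_abs]

lemma hasDerivAt_concave_parabola (p c x₀ x : ℝ) :
    HasDerivAt (fun y => p * (y - x₀) - c * (y - x₀) ^ 2) (p - 2 * c * (x - x₀)) x := by
  have h : HasDerivAt (fun y => y - x₀) 1 x := (hasDerivAt_id x).sub_const x₀
  refine ((h.const_mul p).fun_sub ((h.fun_pow 2).const_mul c)).congr_deriv ?_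
  push_cast
  ring

/-- Near a point of differentiability, `u` is touched from below by a parabola at small scale `r`
whose opening is `o(1) / r`. -/
lemma exists_isLocalMin_sub_parabola {u : ℝ → ℝ} (hu : Continuous u) {x₀ : ℝ}
    (hdiff : DifferentiableAt ℝ u x₀) {ε δ : ℝ} (hε : 0 < ε) (hδ : 0 < δ) :
    ∃ r, 0 < r ∧ r < δ ∧ ∃ x₁, |x₁ - x₀| < r ∧
      IsLocalMin (fun x => u x - (deriv u x₀ * (x - x₀) - 2 * ε / r * (x - x₀) ^ 2)) x₁ := by
  have h := hdiff.hasDerivAt.isLittleO.def hε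
  obtain ⟨ρ, hρ, hb⟩ := Metric.eventually_nhds_iff.1 h
  obtain ⟨r, hr, hrm⟩ := exists_between (lt_min hρ hδ)
  have hrρ : r < ρ := hrm.trans_le (min_le_left _ _)
  refine ⟨r, hr, hrm.trans_le (min_le_right _ _), ?_⟩
  set f := fun x => u x - (deriv u x₀ * (x - x₀) - 2 * ε / r * (x - x₀) ^ 2) with hf
  have hfc : Continuous f := by fun_prop
  have hsphere : ∀ z ∈ Metric.closedBall x₀ r \ Metric.ball x₀ r, f x₀ < f z := by
    rintro z ⟨hz, hz'⟩
    have hzr : |z - x₀| = r := by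
      rw [Metric.mem_closedBall, Real.dist_eq] at hz
      rw [Metric.mem_ball, Real.dist_eq, not_lt] at hz'
      exact le_antisymm hz hz'
    have h1 := hb (y := z) (by rw [Real.dist_eq, hzr]; exact hrρ)
    simp only [Real.norm_eq_abs, smul_eq_mul, hzr] at h1
    have h2 := (abs_le.1 h1).1
    have h3 : 2 * ε / r * (z - x₀) ^ 2 = 2 * ε * r := by
      rw [← sq_abs, hzr]; field_simp
    have h4 : 0 < ε * r := mul_pos hε hr
    simp only [hf, h3, sub_self]
    nlinarith
  obtain ⟨x₁, hx₁, hmin⟩ := (isCompact_closedBall x₀ r).exists_isMinOn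
    ⟨x₀, Metric.mem_closedBall_self hr.le⟩ hfc.continuousOn
  have hx₁b : x₁ ∈ Metric.ball x₀ r := by
    by_contra hn
    exact (hsphere x₁ ⟨hx₁, hn⟩).not_ge (hmin (Metric.mem_closedBall_self hr.le))
  exact ⟨x₁, by simpa [Real.dist_eq] using hx₁b,
    hmin.isLocalMin (Filter.mem_of_superset (Metric.isOpen_ball.mem_nhds hx₁b)
      Metric.ball_subset_closedBall)⟩

lemma IsViscSupersol.le_of_differentiableAt {lam β κ : ℝ} (hκ : 0 < κ) {a V G : ℝ → ℝ}
    (ha : ∀ x, 0 ≤ a x)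
    (ha_lip : LipschitzWith (Real.toNNReal κ) (fun x => Real.sqrt (a x)))
    (hV_cont : Continuous V) (hG_cont : Continuous G)
    {u : ℝ → ℝ} (hu_cont : Continuous u)
    {x₀ : ℝ} (hdiff : DifferentiableAt ℝ u x₀) (ha₀ : a x₀ = 0)
    (hu : IsViscSupersol a V G β lam u) : G (deriv u x₀) + β * V x₀ ≤ lam := by
  by_contra! hlt
  set p := deriv u x₀ with hp
  have hc : Continuous fun z : ℝ × ℝ × ℝ => z.1 + G z.2.1 + β * V z.2.2 := by fun_prop
  have hev : ∀ᶠ z in nhds ((0, p, x₀) : ℝ × ℝ × ℝ), lam < z.1 + G z.2.1 + β * V z.2.2 :=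
    hc.continuousAt.eventually (lt_mem_nhds (by simpa using hlt))
  obtain ⟨δ, hδ, hball⟩ := Metric.eventually_nhds_iff.1 hev
  set ε := δ / (8 * (1 + κ ^ 2)) with hεdef
  have hε : 0 < ε := by positivity
  have hεδ : 8 * ε + 8 * (κ ^ 2 * ε) = δ := by rw [hεdef]; field_simp
  have hκε : 0 ≤ κ ^ 2 * ε := by positivity
  obtain ⟨r, hr, hrδ, x₁, hx₁, hmin⟩ :=
    exists_isLocalMin_sub_parabola hu_cont hdiff hε (lt_min hδ one_pos)
  have hr1 : r < 1 := hrδ.trans_le (min_le_right _ _)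
  have hrδ' : r < δ := hrδ.trans_le (min_le_left _ _)
  have hd : deriv (fun y => p * (y - x₀) - 2 * ε / r * (y - x₀) ^ 2) =
      fun y => p - 2 * (2 * ε / r) * (y - x₀) :=
    funext fun y => (hasDerivAt_concave_parabola p _ x₀ y).deriv
  have hdd : deriv (fun y => p - 2 * (2 * ε / r) * (y - x₀)) x₁ = -(4 * ε / r) := by
    have h := (((hasDerivAt_id x₁).sub_const x₀).const_mul (2 * (2 * ε / r))).const_sub p
    refine h.deriv.trans ?_
    ring
  have key := hu x₁ _ (by fun_prop) hmin
  rw [hd, hdd] at key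
  refine absurd key (not_le.2 (hball (y := (_, _, _)) ?_))
  simp only [Prod.dist_eq, Real.dist_eq, max_lt_iff]
  refine ⟨?_, ?_, hx₁.trans hrδ'⟩
  · have hsq : (x₁ - x₀) ^ 2 ≤ r ^ 2 := by
      rw [← sq_abs]; gcongr
    have h1 : a x₁ ≤ κ ^ 2 * r ^ 2 :=
      (le_sq_of_lipschitzWith_sqrt hκ ha ha_lip ha₀ x₁).trans (by gcongr)
    rw [sub_zero, mul_neg, abs_neg, abs_of_nonneg (mul_nonneg (ha x₁) (by positivity))]
    calc a x₁ * (4 * ε / r) ≤ κ ^ 2 * r ^ 2 * (4 * ε / r) := by gcongr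
      _ = 4 * (κ ^ 2 * ε) * r := by field_simp
      _ ≤ 4 * (κ ^ 2 * ε) * 1 := by gcongr
      _ < δ := by linarith
  · have h1 : p - 2 * (2 * ε / r) * (x₁ - x₀) - p = -((4 * ε / r) * (x₁ - x₀)) := by ring
    rw [h1, abs_neg, abs_mul, abs_of_pos (by positivity : 0 < 4 * ε / r)]
    calc 4 * ε / r * |x₁ - x₀| ≤ 4 * ε / r * r := by gcongr
      _ = 4 * ε := by field_simp
      _ < δ := by linarith

lemma IsViscSubsol.neg {lam β : ℝ} {a V G u : ℝ → ℝ} (hu : IsViscSubsol a V G β lam u) :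
    IsViscSupersol a (fun x => -V x) (fun q => -G (-q)) β (-lam) (fun x => -u x) := by
  intro x φ hφ hmin
  have h := hu x (fun y => -φ y) hφ.neg (by
    simpa [sub_eq_add_neg, add_comm] using hmin.neg)
  have hd : deriv (fun y => -φ y) = fun y => -deriv φ y := funext fun y => deriv.fun_neg
  rw [hd, deriv.fun_neg] at h
  linarith

theorem degenerate_point_pointwise_inequality
    (lam β : ℝ) (hβ : 0 ≤ β) (κ : ℝ) (hκ : 0 < κ)
    (a V G : ℝ → ℝ)
    (ha_range : ∀ x, a x ∈ Set.Icc (0 : ℝ) 1)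
    (ha_lip : LipschitzWith (Real.toNNReal κ) (fun x => Real.sqrt (a x)))
    (hV_cont : Continuous V) (hG_cont : Continuous G)
    (u : ℝ → ℝ) (hu_cont : Continuous u)
    (x₀ : ℝ) (hdiff : DifferentiableAt ℝ u x₀) (ha₀ : a x₀ = 0) :
    (IsViscSupersol a V G β lam u → G (deriv u x₀) + β * V x₀ ≤ lam) ∧
    (IsViscSubsol a V G β lam u → lam ≤ G (deriv u x₀) + β * V x₀) := by
  refine ⟨fun hu => hu.le_of_differentiableAt hκ (fun x => (ha_range x).1) ha_lip hV_cont hG_cont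
    hu_cont hdiff ha₀, fun hu => ?_⟩
  have h := hu.neg.le_of_differentiableAt hκ (fun x => (ha_range x).1) ha_lip hV_cont.neg
    (hG_cont.comp continuous_neg).neg hu_cont.neg hdiff.neg ha₀
  simp only [Pi.neg_apply, Function.comp_apply, deriv.neg, neg_neg] at h
  linarith
end

section
/- Let I ⊆ ℝ be an open interval, let a : ℝ → [0,1] be Lipschitz continuous with a > 0 on I and a = 0 on ∂I when this set is nonempty, let V : ℝ → [0,1] be continuous, β ≥ 0, λ ∈ ℝ, η > 0, and let G : ℝ → ℝ be locally Lipschitz with G(q) − G(p) ≥ η(q − p) for all q > p ≥ 0. Let 0 ≤ p₁ ≤ p₂ and let f₁, f₂ : I → ℝ be differentiable functions taking values in [p₁,p₂] that satisfy a(x)fᵢ'(x) + G(fᵢ(x)) + βV(x) = λ for every x ∈ I (i = 1,2). Then f₁ = f₂ on I. -/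
open Real Set MeasureTheory

/-- A nonnegative bounded `u` with `a u' ≤ -k u` and a comparison function `φ` with `a φ' ≤ 1`:
the total increase of `φ` to the left of `x₀` is controlled by the bound on `u`. -/
lemma mul_sub_le_of_mul_deriv_le {I : Set ℝ} (hI : I.OrdConnected) {a u u' φ φ' : ℝ → ℝ}
    {k B x₀ : ℝ} (hk : 0 ≤ k) (ha : ∀ x ∈ I, 0 < a x) (hu : ∀ x ∈ I, HasDerivAt u (u' x) x)
    (hφ : ∀ x ∈ I, HasDerivAt φ (φ' x) x) (hu_nonneg : ∀ x ∈ I, 0 ≤ u x) (huB : ∀ x ∈ I, u x ≤ B)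
    (hu_ineq : ∀ x ∈ I, a x * u' x ≤ -(k * u x)) (hφ_ineq : ∀ x ∈ I, a x * φ' x ≤ 1)
    (hx₀ : x₀ ∈ I) {x : ℝ} (hx : x ∈ I) (hxx₀ : x ≤ x₀) :
    k * u x₀ * (φ x₀ - φ x) ≤ B := by
  have hu_anti : AntitoneOn u I := by
    refine antitoneOn_of_deriv_nonpos hI.convex
      (fun y hy => (hu y hy).continuousAt.continuousWithinAt)
      (fun y hy => (hu y (interior_subset hy)).differentiableAt.differentiableWithinAt) ?_
    intro y hy
    have hyI := interior_subset hy
    rw [(hu y hyI).deriv]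
    have h1 := hu_ineq y hyI
    have h2 := mul_nonneg hk (hu_nonneg y hyI)
    by_contra! h
    have h3 := mul_pos (ha y hyI) h
    linarith
  have hsub : Icc x x₀ ⊆ I := hI.out hx hx₀
  have hderiv : ∀ y ∈ Icc x x₀,
      HasDerivAt (fun z => u z + k * u x₀ * φ z) (u' y + k * u x₀ * φ' y) y := fun y hy =>
    (hu y (hsub hy)).add ((hφ y (hsub hy)).const_mul _)
  have hanti : AntitoneOn (fun z => u z + k * u x₀ * φ z) (Icc x x₀) := by
    refine antitoneOn_of_deriv_nonpos (convex_Icc x x₀)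
      (fun y hy => (hderiv y hy).continuousAt.continuousWithinAt)
      (fun y hy => (hderiv y (interior_subset hy)).differentiableAt.differentiableWithinAt) ?_
    intro y hy
    have hy' := interior_subset hy
    rw [(hderiv y hy').deriv]
    have hyI := hsub hy'
    have h1 := hu_ineq y hyI
    have h2 : u x₀ ≤ u y := hu_anti hyI hx₀ hy'.2
    have h3 := mul_le_mul_of_nonneg_left h2 hk
    have h4 := mul_le_mul_of_nonneg_left (hφ_ineq y hyI) (mul_nonneg hk (hu_nonneg x₀ hx₀))
    by_contra! h
    have h5 := mul_pos (ha y hyI) h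
    linarith
  have h := hanti (left_mem_Icc.2 hxx₀) (right_mem_Icc.2 hxx₀) hxx₀
  have h1 := huB x hx
  have h2 := hu_nonneg x₀ hx₀
  simp only at h
  linarith

theorem classical_solutions_unique_on_degenerate_interval
    (I : Set ℝ) (hI_open : IsOpen I) (hI_conn : I.OrdConnected)
    (a : ℝ → ℝ) (L : NNReal) (ha_lip : LipschitzWith L a)
    (ha_range : ∀ x, a x ∈ Set.Icc (0 : ℝ) 1)
    (ha_pos : ∀ x ∈ I, 0 < a x)
    (ha_bdry : ∀ x ∈ frontier I, a x = 0)
    (V : ℝ → ℝ) (hV_cont : Continuous V) (hV_range : ∀ x, V x ∈ Set.Icc (0 : ℝ) 1)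
    (β lam η : ℝ) (hβ : 0 ≤ β) (hη : 0 < η)
    (G : ℝ → ℝ) (hG_locLip : LocallyLipschitz G)
    (hG_mono : ∀ p q : ℝ, 0 ≤ p → p < q → η * (q - p) ≤ G q - G p)
    (p₁ p₂ : ℝ) (hp₁ : 0 ≤ p₁) (hp₁₂ : p₁ ≤ p₂)
    (f₁ f₂ : ℝ → ℝ)
    (hf₁_diff : ∀ x ∈ I, DifferentiableAt ℝ f₁ x)
    (hf₂_diff : ∀ x ∈ I, DifferentiableAt ℝ f₂ x)
    (hf₁_range : ∀ x ∈ I, f₁ x ∈ Set.Icc p₁ p₂)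
    (hf₂_range : ∀ x ∈ I, f₂ x ∈ Set.Icc p₁ p₂)
    (hf₁_ode : ∀ x ∈ I, a x * deriv f₁ x + G (f₁ x) + β * V x = lam)
    (hf₂_ode : ∀ x ∈ I, a x * deriv f₂ x + G (f₂ x) + β * V x = lam) :
    ∀ x ∈ I, f₁ x = f₂ x := by
  intro x₀ hx₀
  by_contra hne
  have hdiss : ∀ x ∈ I, a x * (2 * (f₂ x - f₁ x) * (deriv f₂ x - deriv f₁ x)) ≤
      -(2 * η * (f₂ x - f₁ x) ^ 2) := by
    intro x hx
    have e : a x * (deriv f₂ x - deriv f₁ x) = -(G (f₂ x) - G (f₁ x)) := by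
      linarith [hf₁_ode x hx, hf₂_ode x hx]
    have e' : a x * (2 * (f₂ x - f₁ x) * (deriv f₂ x - deriv f₁ x)) =
        -(2 * ((f₂ x - f₁ x) * (G (f₂ x) - G (f₁ x)))) := by
      linear_combination 2 * (f₂ x - f₁ x) * e
    rw [e']
    rcases lt_trichotomy (f₁ x) (f₂ x) with h | h | h
    · have := hG_mono _ _ (hp₁.trans (hf₁_range x hx).1) h
      nlinarith [mul_le_mul_of_nonneg_left this (sub_nonneg.2 h.le)]
    · simp [h]
    · have := hG_mono _ _ (hp₁.trans (hf₂_range x hx).1) h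
      nlinarith [mul_le_mul_of_nonneg_left this (sub_nonneg.2 h.le)]
  have hu : ∀ x ∈ I, HasDerivAt (fun y => (f₂ y - f₁ y) ^ 2)
      (2 * (f₂ x - f₁ x) * (deriv f₂ x - deriv f₁ x)) x := by
    intro x hx
    refine (((hf₂_diff x hx).hasDerivAt.sub (hf₁_diff x hx).hasDerivAt).pow 2).congr_deriv ?_
    simp
  have hB : ∀ x ∈ I, (f₂ x - f₁ x) ^ 2 ≤ (p₂ - p₁) ^ 2 := by
    intro x hx
    obtain ⟨h1, h2⟩ := hf₁_range x hx
    obtain ⟨h3, h4⟩ := hf₂_range x hx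
    exact sq_le_sq' (by linarith) (by linarith)
  have hκ : 0 < 2 * η * (f₂ x₀ - f₁ x₀) ^ 2 := by
    have : f₂ x₀ - f₁ x₀ ≠ 0 := sub_ne_zero.2 (Ne.symm hne)
    positivity
  have key : ∀ φ φ' : ℝ → ℝ, (∀ x ∈ I, HasDerivAt φ (φ' x) x) → (∀ x ∈ I, a x * φ' x ≤ 1) →
      ∀ x ∈ I, x ≤ x₀ → φ x₀ - φ x ≤ (p₂ - p₁) ^ 2 / (2 * η * (f₂ x₀ - f₁ x₀) ^ 2) := by
    intro φ φ' hφ hφ_ineq x hx hxx₀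
    rw [le_div_iff₀' hκ]
    exact mul_sub_le_of_mul_deriv_le hI_conn (by positivity : 0 ≤ 2 * η) ha_pos hu hφ
      (fun y _ => sq_nonneg _) hB hdiss hφ_ineq hx₀ hx hxx₀
  generalize (p₂ - p₁) ^ 2 / (2 * η * (f₂ x₀ - f₁ x₀) ^ 2) = M at key
  by_cases hbdd : BddBelow I
  · set c := sInf I
    have hcI : c ∉ I := by
      intro hcI
      obtain ⟨y, hyc, hy⟩ := exists_Ioc_subset_of_mem_nhds (hI_open.mem_nhds hcI) ⟨c - 1, by simp⟩
      have hmem : (y + c) / 2 ∈ I := hy ⟨by linarith, by linarith⟩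
      linarith [csInf_le hbdd hmem]
    have hac : a c = 0 := ha_bdry c <| by
      rw [hI_open.frontier_eq]
      exact ⟨csInf_mem_closure ⟨x₀, hx₀⟩ hbdd, hcI⟩
    have hlt : ∀ x ∈ I, c < x := fun x hx =>
      lt_of_le_of_ne (csInf_le hbdd hx) fun h => hcI (h ▸ hx)
    have hL : (0 : ℝ) < L + 1 := by positivity
    have hlog := key (fun x => Real.log (x - c) / (L + 1)) (fun x => 1 / (x - c) / (L + 1))
      (fun x hx => (((hasDerivAt_id x).sub_const c).log
        (sub_pos.2 (hlt x hx)).ne').div_const _) (by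
        intro x hx
        have h := ha_lip.dist_le_mul x c
        have hxc := sub_pos.2 (hlt x hx)
        rw [Real.dist_eq, Real.dist_eq, hac, sub_zero, abs_of_pos (ha_pos x hx),
          abs_of_pos hxc] at h
        rw [div_div, mul_one_div, div_le_one (by positivity)]
        linarith)
    obtain ⟨x, hx, hxlt⟩ := exists_lt_of_csInf_lt
      (b := c + (x₀ - c) * Real.exp (-((L + 1) * (|M| + 1)))) ⟨x₀, hx₀⟩ (by
        have := mul_pos (sub_pos.2 (hlt x₀ hx₀)) (Real.exp_pos (-((L + 1) * (|M| + 1))))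
        linarith)
    have hx₀c := sub_pos.2 (hlt x₀ hx₀)
    have hxc := sub_pos.2 (hlt x hx)
    have hxx₀ : x ≤ x₀ := by
      have : Real.exp (-((L + 1) * (|M| + 1))) ≤ 1 := Real.exp_le_one_iff.2 (by
        have : (0 : ℝ) ≤ (L + 1) * (|M| + 1) := by positivity
        linarith)
      nlinarith
    have h1 := hlog x hx hxx₀
    have h2 := Real.log_lt_log hxc (sub_lt_iff_lt_add'.2 hxlt)
    rw [Real.log_mul hx₀c.ne' (Real.exp_pos _).ne', Real.log_exp] at h2
    rw [← sub_div, div_le_iff₀ hL] at h1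
    nlinarith [le_abs_self M]
  · obtain ⟨x, hx, hxlt⟩ := not_bddBelow_iff.1 hbdd (x₀ - |M| - 1)
    have h := key id (fun _ => 1) (fun x _ => hasDerivAt_id x)
      (fun x _ => by simpa using (ha_range x).2) x hx (by linarith [abs_nonneg M])
    simp only [id] at h
    linarith [le_abs_self M]
end

section
/- Let β ≥ 0, λ ≥ β, let a : ℝ → [0,1] with √a κ-Lipschitz, V : ℝ → [0,1] κ-Lipschitz, and G ∈ 𝒢_sqc. Then: (i) there exists exactly one u ∈ 𝒮^λ_+ with u(0) = 0; (ii) there exists exactly one u ∈ 𝒮^λ_− with u(0) = 0. -/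
open Real Set MeasureTheory

noncomputable section

/-- The class 𝒢: union of the classes 𝒢(α₀,α₁,γ). -/
def MemGclass (G : ℝ → ℝ) : Prop :=
  ∃ α₀ α₁ γ : ℝ, 0 < α₀ ∧ 0 < α₁ ∧ 1 < γ ∧ MemG α₀ α₁ γ G

/-- Condition (G4): strict monotonicity with rate η on both half-lines. -/
def StrictIncrRate (G : ℝ → ℝ) (η : ℝ) : Prop :=
  ∀ p₁ p₂ : ℝ, 0 ≤ p₁ → p₁ < p₂ →
    η * (p₂ - p₁) ≤ G p₂ - G p₁ ∧ η * (p₂ - p₁) ≤ G (-p₂) - G (-p₁)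

/-- The class 𝒢_sqc: G ∈ 𝒢, G(0) = 0 and (G4) for some η > 0. -/
def MemGsqc (G : ℝ → ℝ) : Prop :=
  MemGclass G ∧ G 0 = 0 ∧ ∃ η : ℝ, 0 < η ∧ StrictIncrRate G η

/-- G_+^{-1} : the inverse of the restriction of G to [0,∞). -/
def GplusInv (G : ℝ → ℝ) (y : ℝ) : ℝ := Function.invFunOn G (Set.Ici 0) y

/-- G_−^{-1} : the inverse of the restriction of G to (−∞,0]. -/
def GminusInv (G : ℝ → ℝ) (y : ℝ) : ℝ := Function.invFunOn G (Set.Iic 0) y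

/-- The set 𝒮^λ_+ of Lipschitz viscosity solutions with
u'(x) ∈ [G_+^{-1}(λ−β), G_+^{-1}(λ)] for a.e. x ∈ ℝ. -/
def Splus (a V G : ℝ → ℝ) (β lam : ℝ) : Set (ℝ → ℝ) :=
  {u | (∃ K : NNReal, LipschitzWith K u) ∧ IsViscSol a V G β lam u ∧
    ∀ᵐ x ∂(volume : Measure ℝ),
      deriv u x ∈ Set.Icc (GplusInv G (lam - β)) (GplusInv G lam)}

/-- The set 𝒮^λ_− of Lipschitz viscosity solutions with
u'(x) ∈ [G_−^{-1}(λ), G_−^{-1}(λ−β)] for a.e. x ∈ ℝ. -/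
def Sminus (a V G : ℝ → ℝ) (β lam : ℝ) : Set (ℝ → ℝ) :=
  {u | (∃ K : NNReal, LipschitzWith K u) ∧ IsViscSol a V G β lam u ∧
    ∀ᵐ x ∂(volume : Measure ℝ),
      deriv u x ∈ Set.Icc (GminusInv G lam) (GminusInv G (lam - β))}


section Flow

open Filter Topology

/-- A bounded Lipschitz vector field on the line has integral curves on each `[-T, T]`. -/
lemma exists_integralCurve_Icc {b : ℝ → ℝ} {L : NNReal} (hb : LipschitzWith L b)
    (hbd : ∀ x, |b x| ≤ 1) (x : ℝ) (n : ℕ) :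
    ∃ X : ℝ → ℝ, X 0 = x ∧ ∀ t ∈ Icc (-(n + 1) : ℝ) (n + 1),
      HasDerivWithinAt X (b (X t)) (Icc (-(n + 1) : ℝ) (n + 1)) t := by
  have hn : (0 : ℝ) ≤ n := n.cast_nonneg
  have h : IsPicardLindelof (fun _ : ℝ => b) (tmin := -(n + 1)) (tmax := n + 1)
      ⟨0, by constructor <;> linarith⟩ x (n + 1 : NNReal) 0 1 L :=
    { lipschitzOnWith := fun t _ => hb.lipschitzOnWith
      continuousOn := fun y _ => continuousOn_const
      norm_le := fun t _ y _ => by simpa using hbd y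
      mul_max_le := by simp }
  exact h.exists_eq_forall_mem_Icc_hasDerivWithinAt₀

/-- A bounded Lipschitz vector field on the line has a global integral curve through each point. -/
lemma exists_integralCurve {b : ℝ → ℝ} {L : NNReal} (hb : LipschitzWith L b)
    (hbd : ∀ x, |b x| ≤ 1) (x : ℝ) :
    ∃ X : ℝ → ℝ, X 0 = x ∧ ∀ t, HasDerivAt X (b (X t)) t := by
  choose Y hY0 hY using exists_integralCurve_Icc hb hbd x
  have hY' : ∀ n : ℕ, ∀ t ∈ Ioo (-(n + 1) : ℝ) (n + 1), HasDerivAt (Y n) (b (Y n t)) t :=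
    fun n t ht => (hY n t (Ioo_subset_Icc_self ht)).hasDerivAt (Icc_mem_nhds ht.1 ht.2)
  have huniq : ∀ m n : ℕ, m ≤ n → ∀ t ∈ Ioo (-(m + 1) : ℝ) (m + 1), Y m t = Y n t := by
    intro m n hmn t ht
    have hmn' : (m : ℝ) ≤ n := by exact_mod_cast hmn
    have hm : (0 : ℝ) ≤ m := m.cast_nonneg
    refine ODE_solution_unique_of_mem_Ioo (v := fun _ => b) (s := fun _ => univ) (K := L)
      (t₀ := 0) (a := -(m + 1)) (b := m + 1)
      (fun _ _ => hb.lipschitzOnWith) ⟨by linarith, by linarith⟩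
      (fun s hs => ⟨hY' m s hs, trivial⟩)
      (fun s hs => ⟨hY' n s ⟨by linarith [hs.1], by linarith [hs.2]⟩, trivial⟩)
      (by rw [hY0, hY0]) ht
  have hbound : ∀ t : ℝ, t ∈ Ioo (-((⌈|t|⌉₊ : ℕ) + 1) : ℝ) ((⌈|t|⌉₊ : ℕ) + 1) := by
    intro t
    have h := Nat.le_ceil |t|
    exact ⟨by linarith [neg_abs_le t], by linarith [le_abs_self t]⟩
  refine ⟨fun t => Y ⌈|t|⌉₊ t, by simp [hY0], fun t => ?_⟩
  refine (hY' _ t (hbound t)).congr_of_eventuallyEq ?_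
  filter_upwards [Ioo_mem_nhds (hbound t).1 (hbound t).2] with s hs
  rcases le_total ⌈|s|⌉₊ ⌈|t|⌉₊ with h | h
  · exact huniq _ _ h s (hbound s)
  · exact (huniq _ _ h s hs).symm

/-- A family `X` of curves is the flow of the autonomous field `b`. -/
structure IsFlow (b : ℝ → ℝ) (X : ℝ → ℝ → ℝ) : Prop where
  zero : ∀ x, X x 0 = x
  hasDerivAt : ∀ x t, HasDerivAt (X x) (b (X x t)) t

lemma exists_isFlow {b : ℝ → ℝ} {L : NNReal} (hb : LipschitzWith L b) (hbd : ∀ x, |b x| ≤ 1) :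
    ∃ X, IsFlow b X := by
  choose X h0 h using exists_integralCurve hb hbd
  exact ⟨X, h0, h⟩

namespace IsFlow

variable {b : ℝ → ℝ} {X : ℝ → ℝ → ℝ} {L : NNReal}

lemma continuous_time (hX : IsFlow b X) (x : ℝ) : Continuous (X x) :=
  continuous_iff_continuousAt.2 fun t => (hX.hasDerivAt x t).continuousAt

lemma eq_of_hasDerivAt (hX : IsFlow b X) (hb : LipschitzWith L b) {Y : ℝ → ℝ} {x : ℝ}
    (h0 : Y 0 = x) (hY : ∀ t, HasDerivAt Y (b (Y t)) t) : X x = Y :=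
  ODE_solution_unique_univ (v := fun _ => b) (s := fun _ => univ) (K := L) (t₀ := 0)
    (fun _ => hb.lipschitzOnWith) (fun t => ⟨hX.hasDerivAt x t, trivial⟩)
    (fun t => ⟨hY t, trivial⟩) (by rw [hX.zero, h0])

lemma add (hX : IsFlow b X) (hb : LipschitzWith L b) (x s t : ℝ) :
    X (X x s) t = X x (t + s) := by
  have := hX.eq_of_hasDerivAt hb (Y := fun t => X x (t + s)) (x := X x s) (by simp)
    (fun t => (hX.hasDerivAt x (t + s)).comp_add_const t s)
  rw [this]

lemma eq_self_of_eq_zero (hX : IsFlow b X) (hb : LipschitzWith L b) {x : ℝ} (hx : b x = 0)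
    (t : ℝ) : X x t = x := by
  have := hX.eq_of_hasDerivAt hb (Y := fun _ => x) (x := x) rfl
    (fun t => by rw [hx]; exact hasDerivAt_const t x)
  rw [this]

lemma dist_le (hX : IsFlow b X) (hb : LipschitzWith L b) (x y : ℝ) {t : ℝ} (ht : 0 ≤ t) :
    dist (X x t) (X y t) ≤ dist x y * exp (L * t) := by
  have := dist_le_of_trajectories_ODE (v := fun _ => b) (K := L) (f := X x) (g := X y)
    (a := 0) (b := t) (δ := dist x y) (fun _ => hb) (hX.continuous_time x).continuousOn
    (fun s _ => (hX.hasDerivAt x s).hasDerivWithinAt) (hX.continuous_time y).continuousOn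
    (fun s _ => (hX.hasDerivAt y s).hasDerivWithinAt) (by rw [hX.zero, hX.zero]) t ⟨ht, le_rfl⟩
  simpa using this

lemma continuous_space (hX : IsFlow b X) (hb : LipschitzWith L b) {t : ℝ} (ht : 0 ≤ t) :
    Continuous fun x => X x t := by
  refine (LipschitzWith.of_dist_le_mul (K := (exp (L * t)).toNNReal) fun x y => ?_).continuous
  rw [Real.coe_toNNReal _ (exp_pos _).le, mul_comm]
  exact hX.dist_le hb x y ht

end IsFlow

/-- The resolvent (discounted average along the flow) of a function `h`. -/
def flowResolvent (k : ℝ) (X : ℝ → ℝ → ℝ) (h : ℝ → ℝ) (x : ℝ) : ℝ :=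
  ∫ t in Ioi (0 : ℝ), exp (-k * t) * h (X x t)

section Resolvent

variable {b : ℝ → ℝ} {X : ℝ → ℝ → ℝ} {L : NNReal} {k M : ℝ} {h : ℝ → ℝ}

lemma integrableOn_discount_mul {F : ℝ → ℝ} (hk : 0 < k) (hF : Continuous F)
    (hM : ∀ t, |F t| ≤ M) (c : ℝ) : IntegrableOn (fun t => exp (-k * t) * F t) (Ioi c) := by
  refine ((exp_neg_integrableOn_Ioi c hk).const_mul M).mono'
    (by fun_prop) (ae_of_all _ fun t => ?_)
  rw [norm_mul, Real.norm_eq_abs, Real.norm_eq_abs, abs_exp, mul_comm]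
  exact mul_le_mul_of_nonneg_right (hM t) (exp_pos _).le

lemma integral_discount (hk : 0 < k) : ∫ t in Ioi (0 : ℝ), exp (-k * t) = 1 / k := by
  rw [integral_exp_mul_Ioi (neg_lt_zero.2 hk)]
  simp

lemma continuous_flowResolvent (hX : IsFlow b X) (hb : LipschitzWith L b) (hk : 0 < k)
    (hh : Continuous h) (hM : ∀ t, |h t| ≤ M) : Continuous (flowResolvent k X h) := by
  refine continuous_of_dominated (bound := fun t => M * exp (-k * t)) (fun x => ?_) (fun x => ?_)
    ((exp_neg_integrableOn_Ioi 0 hk).const_mul M) ?_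
  · have := hX.continuous_time x
    fun_prop
  · refine ae_of_all _ fun t => ?_
    rw [norm_mul, Real.norm_eq_abs, Real.norm_eq_abs, abs_exp, mul_comm]
    exact mul_le_mul_of_nonneg_right (hM _) (exp_pos _).le
  · filter_upwards [ae_restrict_mem measurableSet_Ioi] with t ht
    have := hX.continuous_space hb (le_of_lt ht)
    fun_prop

lemma integrableOn_flowResolvent (hX : IsFlow b X) (hk : 0 < k)
    (hh : Continuous h) (hM : ∀ t, |h t| ≤ M) (x c : ℝ) :
    IntegrableOn (fun t => exp (-k * t) * h (X x t)) (Ioi c) :=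
  integrableOn_discount_mul hk (hh.comp (hX.continuous_time x)) (fun _ => hM _) c

lemma flowResolvent_le {C : ℝ} (hX : IsFlow b X) (hk : 0 < k)
    (hh : Continuous h) (hM : ∀ t, |h t| ≤ M) (hC : ∀ t, h t ≤ C) (x : ℝ) :
    flowResolvent k X h x ≤ C / k := by
  have h1 : flowResolvent k X h x ≤ ∫ t in Ioi (0 : ℝ), exp (-k * t) * C :=
    integral_mono (integrableOn_flowResolvent hX hk hh hM x 0)
      ((exp_neg_integrableOn_Ioi 0 hk).mul_const C)
      (fun t => mul_le_mul_of_nonneg_left (hC _) (exp_pos _).le)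
  rw [integral_mul_const, integral_discount hk] at h1
  linarith [show 1 / k * C = C / k by ring]

lemma flowResolvent_neg (x : ℝ) :
    flowResolvent k X (fun y => -h y) x = -flowResolvent k X h x := by
  simp [flowResolvent, integral_neg]

lemma le_flowResolvent {C : ℝ} (hX : IsFlow b X) (hk : 0 < k)
    (hh : Continuous h) (hM : ∀ t, |h t| ≤ M) (hC : ∀ t, C ≤ h t) (x : ℝ) :
    C / k ≤ flowResolvent k X h x := by
  have := flowResolvent_le (h := fun y => -h y) (C := -C) hX hk hh.neg
    (fun t => by rw [abs_neg]; exact hM t) (fun t => neg_le_neg (hC t)) x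
  rw [flowResolvent_neg, neg_div] at this
  linarith

lemma flowResolvent_sub {h' : ℝ → ℝ} {M' : ℝ} (hX : IsFlow b X) (hk : 0 < k)
    (hh : Continuous h) (hM : ∀ t, |h t| ≤ M) (hh' : Continuous h') (hM' : ∀ t, |h' t| ≤ M')
    (x : ℝ) :
    flowResolvent k X h x - flowResolvent k X h' x
      = flowResolvent k X (fun y => h y - h' y) x := by
  unfold flowResolvent
  rw [← integral_sub (integrableOn_flowResolvent hX hk hh hM x 0)
    (integrableOn_flowResolvent hX hk hh' hM' x 0)]
  simp only [mul_sub]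

lemma flowResolvent_of_eq_zero (hX : IsFlow b X) (hb : LipschitzWith L b) (hk : 0 < k) {x : ℝ}
    (hx : b x = 0) : k * flowResolvent k X h x = h x := by
  simp only [flowResolvent, hX.eq_self_of_eq_zero hb hx]
  rw [integral_mul_const, integral_discount hk]
  field_simp

lemma hasDerivAt_flowResolvent_comp (hX : IsFlow b X) (hb : LipschitzWith L b) (hk : 0 < k)
    (hh : Continuous h) (hM : ∀ t, |h t| ≤ M) (x : ℝ) :
    HasDerivAt (fun s => flowResolvent k X h (X x s)) (k * flowResolvent k X h x - h x) 0 := by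
  have key : ∀ s, flowResolvent k X h (X x s) = exp (k * s) *
      (flowResolvent k X h x - ∫ t in (0 : ℝ)..s, exp (-k * t) * h (X x t)) := by
    intro s
    have hI := integrableOn_flowResolvent hX hk hh hM x
    have h1 : flowResolvent k X h x - ∫ t in (0 : ℝ)..s, exp (-k * t) * h (X x t)
        = ∫ t in Ioi s, exp (-k * t) * h (X x t) := by
      rw [← intervalIntegral.integral_Ioi_sub_Ioi' (hI 0) (hI s)]
      simp [flowResolvent]
    rw [h1, ← integral_const_mul]
    have h2 := (measurePreserving_add_right volume s).setIntegral_preimage_emb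
      (measurableEmbedding_addRight s)
      (fun t => exp (k * s) * (exp (-k * t) * h (X x t))) (Ioi s)
    rw [preimage_add_const_Ioi, sub_self] at h2
    rw [← h2]
    unfold flowResolvent
    congr 1
    ext t
    rw [hX.add hb, ← mul_assoc, ← exp_add]
    congr 2
    ring
  have hc : Continuous fun t => exp (-k * t) * h (X x t) := by
    have := hX.continuous_time x
    fun_prop
  have h1 : HasDerivAt (fun s => ∫ t in (0 : ℝ)..s, exp (-k * t) * h (X x t)) (h x) 0 := by
    have := hc.integral_hasStrictDerivAt 0 0
    simpa [hX.zero] using this.hasDerivAt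
  have h2 : HasDerivAt (fun s : ℝ => exp (k * s)) k 0 := by
    simpa using ((hasDerivAt_id (0 : ℝ)).const_mul k).exp
  have h3 := h2.mul (h1.const_sub (flowResolvent k X h x))
  simp only [intervalIntegral.integral_same, sub_zero, mul_zero, exp_zero, one_mul] at h3
  rw [show (fun s => flowResolvent k X h (X x s)) = _ from funext key]
  exact h3

lemma hasDerivAt_flowResolvent (hX : IsFlow b X) (hb : LipschitzWith L b) (hk : 0 < k)
    (hh : Continuous h) (hM : ∀ t, |h t| ≤ M) {x : ℝ} (hx : b x ≠ 0) :
    HasDerivAt (flowResolvent k X h) ((k * flowResolvent k X h x - h x) / b x) x := by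
  have hs : HasStrictDerivAt (X x) (b (X x 0)) 0 :=
    hasStrictDerivAt_of_hasDerivAt_of_continuousAt
      (f' := fun t => b (X x t)) (Eventually.of_forall fun t => hX.hasDerivAt x t)
      (hb.continuous.comp (hX.continuous_time x)).continuousAt
  rw [hX.zero] at hs
  have hinv := (hs.to_localInverse hx).hasDerivAt
  have hr := hs.eventually_right_inverse hx
  have hl := (hs.eventually_left_inverse hx).self_of_nhds
  set τ := hs.localInverse (X x) (b x) 0 hx
  rw [hX.zero] at hinv hr hl
  have hc := hasDerivAt_flowResolvent_comp hX hb hk hh hM x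
  rw [← hl] at hc
  have := hc.comp x hinv
  rw [← div_eq_mul_inv] at this
  refine this.congr_of_eventuallyEq ?_
  filter_upwards [hr] with y hy
  simp [hy]

end Resolvent

end Flow

section Profile

/-- `G` has difference quotients in `[η, k]` on `[l, r]`. -/
def SlopeBounds (G : ℝ → ℝ) (η k l r : ℝ) : Prop :=
  ∀ p q : ℝ, l ≤ p → p ≤ q → q ≤ r → η * (q - p) ≤ G q - G p ∧ G q - G p ≤ k * (q - p)

/-- The nondecreasing function `k p - G p` on `[l, r]`, extended by constants. -/
def clampedRemainder (G : ℝ → ℝ) (k l r p : ℝ) : ℝ :=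
  k * max l (min p r) - G (max l (min p r))

variable {G : ℝ → ℝ} {η k l r : ℝ}

lemma clampedRemainder_le_sub (hG : SlopeBounds G η k l r) (hlr : l ≤ r) (hηk : η ≤ k)
    {p q : ℝ} (hpq : p ≤ q) :
    0 ≤ clampedRemainder G k l r q - clampedRemainder G k l r p ∧
    clampedRemainder G k l r q - clampedRemainder G k l r p ≤ (k - η) * (q - p) := by
  have h1 : max l (min p r) ≤ max l (min q r) := by gcongr
  have h2 : max l (min q r) - max l (min p r) ≤ q - p := by grind
  obtain ⟨h3, h4⟩ := hG _ _ (le_max_left l (min p r)) h1 (max_le hlr (min_le_right _ _))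
  unfold clampedRemainder
  constructor
  · linarith
  · nlinarith [mul_le_mul_of_nonneg_left h2 (sub_nonneg.2 hηk)]

lemma abs_clampedRemainder_sub_le (hG : SlopeBounds G η k l r) (hlr : l ≤ r) (hηk : η ≤ k)
    (p q : ℝ) :
    |clampedRemainder G k l r p - clampedRemainder G k l r q| ≤ (k - η) * |p - q| := by
  rcases le_total p q with h | h
  · have := clampedRemainder_le_sub hG hlr hηk h
    rw [abs_sub_comm, abs_of_nonneg this.1, abs_sub_comm, abs_of_nonneg (sub_nonneg.2 h)]
    exact this.2
  · have := clampedRemainder_le_sub hG hlr hηk h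
    rw [abs_of_nonneg this.1, abs_of_nonneg (sub_nonneg.2 h)]
    exact this.2

lemma continuous_clampedRemainder (hG : SlopeBounds G η k l r) (hlr : l ≤ r) (hηk : η ≤ k) :
    Continuous (clampedRemainder G k l r) := by
  refine (LipschitzWith.of_dist_le_mul (K := (k - η).toNNReal) fun p q => ?_).continuous
  rw [Real.coe_toNNReal _ (sub_nonneg.2 hηk)]
  exact abs_clampedRemainder_sub_le hG hlr hηk p q

lemma clampedRemainder_mem (hG : SlopeBounds G η k l r) (hlr : l ≤ r) (p : ℝ) :
    clampedRemainder G k l r p ∈ Icc (k * l - G l) (k * r - G r) := by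
  have h1 : l ≤ max l (min p r) := le_max_left _ _
  have h2 : max l (min p r) ≤ r := max_le hlr (min_le_right _ _)
  have h3 := (hG _ _ le_rfl h1 h2).2
  have h4 := (hG _ _ h1 h2 le_rfl).2
  unfold clampedRemainder
  constructor <;> linarith

/-- Existence of a continuous bounded solution of `a p' + G(p) = f` on the line, where the equation
degenerates to `G(p) = f` on the zero set of `a`. -/
lemma exists_profile {a f : ℝ → ℝ} {L : NNReal} (ha : LipschitzWith L a)
    (ha1 : ∀ x, a x ∈ Icc (0 : ℝ) 1) (hf : Continuous f) (hfl : ∀ x, G l ≤ f x)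
    (hfr : ∀ x, f x ≤ G r) (hη : 0 < η) (hηk : η ≤ k) (hlr : l ≤ r)
    (hG : SlopeBounds G η k l r) :
    ∃ p : ℝ → ℝ, Continuous p ∧ (∀ x, p x ∈ Icc l r) ∧ (∀ x, a x = 0 → G (p x) = f x) ∧
      ∀ x, a x ≠ 0 → HasDerivAt p ((f x - G (p x)) / a x) x := by
  have hk : 0 < k := hη.trans_le hηk
  have hb : LipschitzWith L fun x => -a x := ha.neg
  obtain ⟨X, hX⟩ := exists_isFlow hb fun x => by
    rw [abs_neg, abs_of_nonneg (ha1 x).1]; exact (ha1 x).2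
  set N := clampedRemainder G k l r
  have hN : Continuous N := continuous_clampedRemainder hG hlr hηk
  have hNm : ∀ p, N p ∈ Icc (k * l - G l) (k * r - G r) := clampedRemainder_mem hG hlr
  have hlo : ∀ p x, k * l ≤ f x + N p := fun p x => by linarith [hfl x, (hNm p).1]
  have hup : ∀ p x, f x + N p ≤ k * r := fun p x => by linarith [hfr x, (hNm p).2]
  have hbd : ∀ p x, |f x + N p| ≤ max |k * l| |k * r| := fun p x =>
    abs_le_max_abs_abs (hlo p x) (hup p x)
  have hcont : ∀ p : BoundedContinuousFunction ℝ ℝ, Continuous fun y => f y + N (p y) :=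
    fun p => hf.add (hN.comp p.continuous)
  have hmem : ∀ p : BoundedContinuousFunction ℝ ℝ, ∀ x,
      flowResolvent k X (fun y => f y + N (p y)) x ∈ Icc l r := by
    intro p x
    have h1 := le_flowResolvent hX hk (hcont p) (fun y => hbd _ y) (fun y => hlo (p y) y) x
    have h2 := flowResolvent_le hX hk (hcont p) (fun y => hbd _ y) (fun y => hup (p y) y) x
    rw [mul_div_cancel_left₀ _ hk.ne'] at h1 h2
    exact ⟨h1, h2⟩
  let T : BoundedContinuousFunction ℝ ℝ → BoundedContinuousFunction ℝ ℝ := fun p =>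
    BoundedContinuousFunction.ofNormedAddCommGroup
      (flowResolvent k X fun y => f y + N (p y))
      (continuous_flowResolvent hX hb hk (hcont p) fun y => hbd _ y) (max |l| |r|)
      fun x => abs_le_max_abs_abs (hmem p x).1 (hmem p x).2
  have hT : ContractingWith ((k - η) / k).toNNReal T := by
    have h0 : 0 ≤ (k - η) / k := div_nonneg (sub_nonneg.2 hηk) hk.le
    constructor
    · rw [Real.toNNReal_lt_one, div_lt_one hk]
      linarith
    · refine LipschitzWith.of_dist_le_mul fun p q => ?_
      rw [Real.coe_toNNReal _ h0]
      have hsub : ∀ y, |(f y + N (p y)) - (f y + N (q y))| ≤ (k - η) * dist p q := fun y => by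
        rw [add_sub_add_left_eq_sub]
        refine (abs_clampedRemainder_sub_le hG hlr hηk _ _).trans ?_
        exact mul_le_mul_of_nonneg_left (p.dist_coe_le_dist y) (sub_nonneg.2 hηk)
      have hcs : Continuous fun y => (f y + N (p y)) - (f y + N (q y)) :=
        (hcont p).sub (hcont q)
      refine (BoundedContinuousFunction.dist_le (mul_nonneg h0 dist_nonneg)).2 fun x => ?_
      rw [Real.dist_eq]
      change |flowResolvent k X (fun y => f y + N (p y)) x
        - flowResolvent k X (fun y => f y + N (q y)) x| ≤ _
      rw [flowResolvent_sub hX hk (hcont p) (fun y => hbd _ y) (hcont q) (fun y => hbd _ y),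
        div_mul_eq_mul_div, abs_le]
      constructor
      · have := le_flowResolvent hX hk hcs hsub (fun y => (abs_le.1 (hsub y)).1) x
        rwa [neg_div] at this
      · exact flowResolvent_le hX hk hcs hsub (fun y => (abs_le.1 (hsub y)).2) x
  set p := hT.fixedPoint
  have hp : ∀ x, flowResolvent k X (fun y => f y + N (p y)) x = p x := fun x =>
    DFunLike.congr_fun (hT.fixedPoint_isFixedPt : T p = p) x
  have hpm : ∀ x, p x ∈ Icc l r := fun x => hp x ▸ hmem p x
  have hNp : ∀ x, N (p x) = k * p x - G (p x) := fun x => by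
    simp only [N, clampedRemainder, min_eq_left (hpm x).2, max_eq_right (hpm x).1]
  refine ⟨p, p.continuous, hpm, fun x hx => ?_, fun x hx => ?_⟩
  · have := flowResolvent_of_eq_zero (h := fun y => f y + N (p y)) hX hb hk (x := x)
      (by simp [hx])
    rw [hp] at this
    linarith [hNp x]
  · have := hasDerivAt_flowResolvent hX hb hk (hcont p) (fun y => hbd _ y) (x := x)
      (by simpa using hx)
    rw [show flowResolvent k X (fun y => f y + N (p y)) = p from funext hp] at this
    convert this using 1
    rw [hNp]
    field_simp
    ring

end Profile

section Viscosity

open Filter Topology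

variable {a V G u W W' : ℝ → ℝ} {β lam : ℝ}

lemma isViscSubsol_neg_iff :
    IsViscSubsol a (fun x => -V x) (fun p => -G (-p)) β (-lam) (fun x => -u x) ↔
      IsViscSupersol a V G β lam u := by
  constructor
  · intro h x φ hφ hmin
    have := h x (fun y => -φ y) hφ.neg (by
      have := hmin.neg
      refine this.congr (Eventually.of_forall fun y => ?_)
      ring)
    simp only [deriv.fun_neg', neg_neg] at this
    linarith
  · intro h x φ hφ hmax
    have := h x (fun y => -φ y) hφ.neg (by
      have := hmax.neg
      refine this.congr (Eventually.of_forall fun y => ?_)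
      ring)
    simp only [deriv.fun_neg'] at this
    linarith

/-- Second-order necessary condition at a local maximum. -/
lemma second_deriv_nonpos_of_isLocalMax {D D' : ℝ → ℝ} {D'' x : ℝ}
    (hD : ∀ᶠ y in 𝓝 x, HasDerivAt D (D' y) y) (hD' : HasDerivAt D' D'' x)
    (hmax : IsLocalMax D x) : D'' ≤ 0 := by
  by_contra! hpos
  have he : deriv D =ᶠ[𝓝 x] D' := hD.mono fun y hy => hy.deriv
  have hd2 : deriv (deriv D) x = D'' := by rw [he.deriv_eq, hD'.deriv]
  have hmin := isLocalMin_of_deriv_deriv_pos (by rw [hd2]; exact hpos) hmax.deriv_eq_zero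
    hD.self_of_nhds.continuousAt
  have hconst : D =ᶠ[𝓝 x] fun _ => D x := by
    filter_upwards [hmax, hmin] with y h1 h2 using le_antisymm h1 h2
  have := hconst.deriv.deriv_eq
  simp [hd2] at this
  exact hpos.ne' this

/-- Subsolutions may be tested with functions that are only twice differentiable at a point. -/
lemma IsViscSubsol.le_of_isLocalMax {W'' x : ℝ} (hu : IsViscSubsol a V G β lam u)
    (hW : ∀ᶠ y in 𝓝 x, HasDerivAt W (W' y) y) (hW' : HasDerivAt W' W'' x)
    (hmax : IsLocalMax (fun y => u y - W y) x) :
    lam ≤ a x * W'' + G (W' x) + β * V x := by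
  have key : ∀ ε > 0, lam ≤ a x * (W'' + ε) + G (W' x) + β * V x := by
    intro ε hε
    set φ : ℝ → ℝ := fun y => W' x * (y - x) + (W'' + ε) / 2 * (y - x) ^ 2
    set φ' : ℝ → ℝ := fun y => W' x + (W'' + ε) * (y - x)
    have hφ : ∀ y, HasDerivAt φ (φ' y) y := fun y => by
      have h1 : HasDerivAt (fun y => y - x) 1 y := (hasDerivAt_id y).sub_const x
      have h2 := (h1.const_mul (W' x)).add ((h1.pow 2).const_mul ((W'' + ε) / 2))
      refine h2.congr_deriv ?_
      simp only [φ']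
      norm_num
      ring
    have hφ' : ∀ y, HasDerivAt φ' (W'' + ε) y := fun y => by
      have h1 : HasDerivAt (fun y => y - x) 1 y := (hasDerivAt_id y).sub_const x
      simpa [φ'] using (h1.const_mul (W'' + ε)).const_add (W' x)
    have hd : deriv φ = φ' := funext fun y => (hφ y).deriv
    have hDd : ∀ᶠ y in 𝓝 x, HasDerivAt (fun y => φ y - W y) (φ' y - W' y) y :=
      hW.mono fun y hy => (hφ y).sub hy
    have hDe : deriv (fun y => φ y - W y) =ᶠ[𝓝 x] fun y => φ' y - W' y :=
      hDd.mono fun y hy => hy.deriv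
    have hmin : IsLocalMin (fun y => φ y - W y) x := by
      refine isLocalMin_of_deriv_deriv_pos ?_ ?_ hDd.self_of_nhds.continuousAt
      · rw [hDe.deriv_eq, ((hφ' x).fun_sub hW').deriv]
        linarith
      · rw [hDe.self_of_nhds]
        simp [φ']
    have hmax' : IsLocalMax (fun y => u y - φ y) x := by
      filter_upwards [hmax, hmin] with y h1 h2
      linarith
    have := hu x φ (by fun_prop) hmax'
    rw [hd, (hφ' x).deriv] at this
    simpa [φ'] using this
  have hlim : Tendsto (fun ε : ℝ => a x * (W'' + ε) + G (W' x) + β * V x) (𝓝[>] 0)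
      (𝓝 (a x * (W'' + 0) + G (W' x) + β * V x)) := by
    refine Tendsto.mono_left ?_ nhdsWithin_le_nhds
    exact Continuous.tendsto (by fun_prop) 0
  rw [add_zero] at hlim
  exact ge_of_tendsto hlim (by filter_upwards [self_mem_nhdsWithin] with ε hε using key ε hε)

/-- Classical subsolutions, of class `C²` off the zero set of `a`, are viscosity subsolutions. -/
lemma isViscSubsol_of_hasDerivAt {v p : ℝ → ℝ} (ha : ∀ x, 0 ≤ a x)
    (hv : ∀ x, HasDerivAt v (p x) x) (h0 : ∀ x, a x = 0 → G (p x) + β * V x = lam)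
    (h1 : ∀ x, a x ≠ 0 → ∃ p', HasDerivAt p p' x ∧ a x * p' + G (p x) + β * V x = lam) :
    IsViscSubsol a V G β lam v := by
  intro x φ hφ hmax
  have hφd : ∀ y, HasDerivAt φ (deriv φ y) y := fun y =>
    (hφ.differentiable (by norm_num) y).hasDerivAt
  have hφ2 : HasDerivAt (deriv φ) (deriv (deriv φ) x) x :=
    ((hφ.iterate_deriv' 1 1).differentiable (by norm_num) x).hasDerivAt
  have hD : ∀ y, HasDerivAt (fun y => v y - φ y) (p y - deriv φ y) y := fun y =>
    (hv y).sub (hφd y)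
  have hp : deriv φ x = p x := by
    have := hmax.hasDerivAt_eq_zero (hD x)
    linarith
  rw [hp]
  by_cases hx : a x = 0
  · rw [hx, zero_mul, zero_add, h0 x hx]
  · obtain ⟨p', hp', he⟩ := h1 x hx
    have := second_deriv_nonpos_of_isLocalMax (Eventually.of_forall hD) (hp'.sub hφ2) hmax
    nlinarith [mul_nonneg (ha x) (sub_nonneg.2 (sub_nonpos.1 this))]

lemma isViscSol_of_hasDerivAt {v p : ℝ → ℝ} (ha : ∀ x, 0 ≤ a x)
    (hv : ∀ x, HasDerivAt v (p x) x) (h0 : ∀ x, a x = 0 → G (p x) + β * V x = lam)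
    (h1 : ∀ x, a x ≠ 0 → ∃ p', HasDerivAt p p' x ∧ a x * p' + G (p x) + β * V x = lam) :
    IsViscSol a V G β lam v := by
  refine ⟨continuous_iff_continuousAt.2 fun x => (hv x).continuousAt,
    isViscSubsol_of_hasDerivAt ha hv h0 h1, isViscSubsol_neg_iff.1 ?_⟩
  refine isViscSubsol_of_hasDerivAt (p := fun x => -p x) ha (fun x => (hv x).neg) ?_ ?_
  · intro x hx
    simp only [neg_neg]
    linarith [h0 x hx]
  · intro x hx
    obtain ⟨p', hp', he⟩ := h1 x hx
    refine ⟨-p', hp'.neg, ?_⟩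
    simp only [neg_neg]
    linarith

/-- At a zero of `a`, a differentiable subsolution satisfies the first-order inequality. -/
lemma IsViscSubsol.le_of_hasDerivAt {c D L : ℝ} (hu : IsViscSubsol a V G β lam u)
    (huc : Continuous u) (hG : Continuous G) (hV : Continuous V)
    (ha : ∀ y, a y ≤ L * |y - c|) (hD : HasDerivAt u D c) :
    lam ≤ G D + β * V c := by
  by_contra! hlt
  have hF : Continuous fun q : ℝ × ℝ × ℝ => 4 * |L| * q.1 + G (D + q.2.1) + β * V (c + q.2.2) := by
    fun_prop
  have hev : ∀ᶠ q : ℝ × ℝ × ℝ in 𝓝 (0, 0, 0),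
      4 * |L| * q.1 + G (D + q.2.1) + β * V (c + q.2.2) < lam :=
    hF.continuousAt.eventually_lt_const (by simpa using hlt)
  obtain ⟨ρ, hρ, hball⟩ := Metric.eventually_nhds_iff_ball.1 hev
  set ε := ρ / 8
  have hε : 0 < ε := by positivity
  have hlo := (hasDerivAt_iff_isLittleO.1 hD).def hε
  obtain ⟨r₀, hr₀, hr₀'⟩ := Metric.eventually_nhds_iff_ball.1 hlo
  set r := min (r₀ / 2) (ρ / 2)
  have hr : 0 < r := by positivity
  have hrr₀ : r < r₀ := (min_le_left _ _).trans_lt (by linarith)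
  have hrρ : r < ρ := (min_le_right _ _).trans_lt (by linarith)
  have hosc : ∀ y ∈ Icc (c - r) (c + r), |u y - u c - (y - c) * D| ≤ ε * |y - c| := by
    intro y hy
    have := hr₀' y (by rw [Metric.mem_ball, Real.dist_eq, abs_lt]; constructor <;>
      linarith [hy.1, hy.2])
    simpa using this
  set φ : ℝ → ℝ := fun y => D * (y - c) + 2 * ε / r * (y - c) ^ 2
  have hφ : ∀ y, HasDerivAt φ (D + 4 * ε / r * (y - c)) y := fun y => by
    have h1 : HasDerivAt (fun y => y - c) 1 y := (hasDerivAt_id y).sub_const c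
    have h2 := (h1.const_mul D).add ((h1.pow 2).const_mul (2 * ε / r))
    refine h2.congr_deriv ?_
    norm_num
    ring
  have hd : deriv φ = fun y => D + 4 * ε / r * (y - c) := funext fun y => (hφ y).deriv
  have hd2 : ∀ y, deriv (deriv φ) y = 4 * ε / r := fun y => by
    rw [hd]
    have h1 : HasDerivAt (fun y => y - c) 1 y := (hasDerivAt_id y).sub_const c
    simp [((h1.const_mul (4 * ε / r)).const_add D).deriv]
  obtain ⟨x, hx, hxmax⟩ := isCompact_Icc.exists_isMaxOn (s := Icc (c - r) (c + r))
    ⟨c, by constructor <;> linarith⟩ (f := fun y => u y - φ y)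
    (by fun_prop)
  have hcx : u c - φ c ≤ u x - φ x := hxmax ⟨by linarith, by linarith⟩
  have hφc : φ c = 0 := by simp [φ]
  have hox := (abs_le.1 (hosc x hx)).2
  have hne : |x - c| ≠ r := by
    intro he
    have : φ x = D * (x - c) + 2 * ε * r := by
      simp only [φ]
      rw [← sq_abs, he]
      field_simp
    rw [he] at hox
    nlinarith
  have habs : |x - c| < r := lt_of_le_of_ne
    (abs_le.2 ⟨by linarith [hx.1], by linarith [hx.2]⟩) hne
  obtain ⟨hx1, hx2⟩ := abs_lt.1 habs
  have hloc : IsLocalMax (fun y => u y - φ y) x :=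
    hxmax.isLocalMax (Icc_mem_nhds (by linarith) (by linarith))
  have htest := hu x φ (by fun_prop) hloc
  rw [hd2, hd] at htest
  have ha' : a x * (4 * ε / r) ≤ 4 * |L| * ε := by
    have h1 : a x ≤ |L| * r := (ha x).trans <|
      mul_le_mul (le_abs_self L) habs.le (abs_nonneg _) (abs_nonneg _)
    calc a x * (4 * ε / r) ≤ |L| * r * (4 * ε / r) := by gcongr
      _ = 4 * |L| * ε := by field_simp
  have hsl : |4 * ε / r * (x - c)| < ρ := by
    rw [abs_mul, abs_of_pos (by positivity)]
    calc 4 * ε / r * |x - c| ≤ 4 * ε / r * r := by gcongr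
      _ = ρ / 2 := by field_simp; simp only [ε]; ring
      _ < ρ := by linarith
  have := hball (ε, 4 * ε / r * (x - c), x - c) (by
    simp only [Metric.mem_ball, Prod.dist_eq, Real.dist_eq, sub_zero, max_lt_iff]
    refine ⟨?_, hsl, habs.trans hrρ⟩
    rw [abs_of_pos hε]
    simp only [ε]
    linarith)
  simp only [add_sub_cancel] at this
  linarith

lemma IsViscSol.eq_of_hasDerivAt {c D L : ℝ} (hu : IsViscSol a V G β lam u)
    (hG : Continuous G) (hV : Continuous V)
    (ha : ∀ y, a y ≤ L * |y - c|) (hD : HasDerivAt u D c) :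
    G D + β * V c = lam := by
  refine le_antisymm ?_ (hu.2.1.le_of_hasDerivAt hu.1 hG hV ha hD)
  have := (isViscSubsol_neg_iff.2 hu.2.2).le_of_hasDerivAt hu.1.neg (by fun_prop) hV.neg ha hD.neg
  rw [neg_neg] at this
  linarith

end Viscosity

section Comparison

open Filter Topology

/-- `w + Γ` has no local maximum where `a > 0`, for every `Γ` with derivative `g > 0` satisfying
`a g' + η g > 0`. This is the one-sided viscosity inequality for differences of solutions. -/
def NoPerturbedMax (a : ℝ → ℝ) (η : ℝ) (w : ℝ → ℝ) : Prop :=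
  ∀ (x : ℝ) (Γ g : ℝ → ℝ) (g' : ℝ), 0 < a x → (∀ᶠ y in 𝓝 x, HasDerivAt Γ (g y) y) →
    HasDerivAt g g' x → 0 < g x → 0 < a x * g' + η * g x →
    ¬ IsLocalMax (fun y => w y + Γ y) x

variable {a w : ℝ → ℝ} {η : ℝ}

namespace NoPerturbedMax

lemma le_add {Γ g g' : ℝ → ℝ} {y s t : ℝ} (h : NoPerturbedMax a η w) (hw : Continuous w)
    (hys : y < s) (hst : s < t) (ha : ∀ x ∈ Ioo y t, 0 < a x) (hΓc : ContinuousOn Γ (Icc y t))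
    (hΓ : ∀ x ∈ Ioo y t, HasDerivAt Γ (g x) x) (hg : ∀ x ∈ Ioo y t, HasDerivAt g (g' x) x)
    (hgpos : ∀ x ∈ Ioo y t, 0 < g x) (hineq : ∀ x ∈ Ioo y t, 0 < a x * g' x + η * g x)
    (hlt : w t + Γ t < w s + Γ s) : w s + Γ s ≤ w y + Γ y := by
  obtain ⟨x, hx, hmax⟩ := isCompact_Icc.exists_isMaxOn (s := Icc y t)
    ⟨y, by constructor <;> linarith⟩ (f := fun x => w x + Γ x) (hw.continuousOn.add hΓc)
  have hs : w s + Γ s ≤ w x + Γ x := hmax ⟨hys.le, hst.le⟩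
  rcases eq_or_lt_of_le hx.1 with rfl | hyx
  · exact hs
  rcases eq_or_lt_of_le hx.2 with rfl | hxt
  · linarith
  · have hx' : x ∈ Ioo y t := ⟨hyx, hxt⟩
    exact absurd (hmax.isLocalMax (Icc_mem_nhds hyx hxt))
      (h x Γ g (g' x) (ha x hx') (mem_of_superset (Ioo_mem_nhds hyx hxt) hΓ) (hg x hx')
        (hgpos x hx') (hineq x hx'))

lemma lt_of_lt (h : NoPerturbedMax a η w) (hη : 0 < η) (hw : Continuous w) {y s t : ℝ}
    (hys : y < s) (hst : s < t) (ha : ∀ x ∈ Ioo y t, 0 < a x) (hlt : w t < w s) : w s < w y := by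
  set δ := (w s - w t) / (2 * (t - s))
  have hts : 0 < t - s := sub_pos.2 hst
  have hδ : 0 < δ := div_pos (sub_pos.2 hlt) (by positivity)
  have hδ' : δ * (t - s) = (w s - w t) / 2 := by
    simp only [δ]
    field_simp
  have := h.le_add (Γ := fun x => δ * x) (g := fun _ => δ) (g' := fun _ => 0) hw hys hst ha
    (by fun_prop) (fun x _ => by simpa using (hasDerivAt_id x).const_mul δ)
    (fun x _ => hasDerivAt_const x δ) (fun _ _ => hδ) (fun _ _ => by simp; positivity)
    (by linarith)
  nlinarith

lemma le_of_zero (h : NoPerturbedMax a η w) (hη : 0 < η) (hw : Continuous w) {A c s t : ℝ}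
    (hA : 0 < A) (haA : ∀ x, a x ≤ A * (x - c) ^ 2) (hcs : c < s) (hst : s < t)
    (ha : ∀ x ∈ Ioo c t, 0 < a x) : w s ≤ w t := by
  by_contra! hlt
  set r := min ((s - c) / 2) (η / (2 * A))
  have hr : 0 < r := lt_min (by linarith) (by positivity)
  have hrs : c + r < s := by linarith [min_le_left ((s - c) / 2) (η / (2 * A))]
  have hrA : A * r < η := by
    calc A * r ≤ A * (η / (2 * A)) := by gcongr; exact min_le_right _ _
      _ = η / 2 := by field_simp
      _ < η := by linarith
  have hsub : ∀ y t', c ≤ y → t' ≤ t → ∀ x ∈ Ioo y t', 0 < a x := fun y t' hy ht' x hx =>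
    ha x ⟨hy.trans_lt hx.1, hx.2.trans_le ht'⟩
  have h1 : w s < w (c + r) :=
    h.lt_of_lt hη hw hrs hst (hsub _ _ (by linarith) le_rfl) hlt
  have h2 : w (c + r) < w (c + r / 2) :=
    h.lt_of_lt hη hw (by linarith) hrs (hsub _ _ (by linarith) hst.le) h1
  have hlog : log (r / 2) < log r := log_lt_log (by positivity) (by linarith)
  set δ := (w (c + r / 2) - w (c + r)) / (2 * (log r - log (r / 2)))
  have hlog' : 0 < log r - log (r / 2) := sub_pos.2 hlog
  have hδ : 0 < δ := div_pos (sub_pos.2 h2) (by positivity)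
  have hδ' : δ * (log r - log (r / 2)) = (w (c + r / 2) - w (c + r)) / 2 := by
    simp only [δ]
    field_simp
  obtain ⟨m, -, hm⟩ := isCompact_Icc.exists_isMaxOn (s := Icc c t)
    ⟨c, by constructor <;> linarith⟩ hw.continuousOn
  have hmge : w (c + r / 2) ≤ w m := hm ⟨by linarith, by linarith⟩
  set E := (w m - w (c + r / 2)) / δ
  have hE : 0 ≤ E := div_nonneg (by linarith) hδ.le
  set ρ := r / 2 * exp (-(E + 1))
  have hρ : 0 < ρ := by positivity
  have hρr : ρ < r / 2 := mul_lt_of_lt_one_right (by positivity) (exp_lt_one_iff.2 (by linarith))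
  have hlogρ : log ρ = log (r / 2) - (E + 1) := by
    rw [log_mul (by positivity) (exp_pos _).ne', log_exp]
    ring
  have := h.le_add (y := c + ρ) (s := c + r / 2) (t := c + r)
    (Γ := fun x => δ * log (x - c)) (g := fun x => δ * (x - c)⁻¹)
    (g' := fun x => δ * (-1 / (x - c) ^ 2)) hw (by linarith) (by linarith)
    (hsub _ _ (by linarith) (by linarith))
    (by
      refine ContinuousOn.const_mul (ContinuousOn.log (by fun_prop) fun x hx => ?_) δ |>.congr
        fun x _ => rfl
      have := hx.1
      linarith)
    (fun x hx => by
      have hxc : x - c ≠ 0 := by linarith [hx.1]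
      have := ((hasDerivAt_id x).sub_const c).log hxc
      simpa using this.const_mul δ)
    (fun x hx => by
      have hxc : x - c ≠ 0 := by linarith [hx.1]
      exact (((hasDerivAt_id x).sub_const c).fun_inv hxc).const_mul δ)
    (fun x hx => mul_pos hδ (inv_pos.2 (by linarith [hx.1])))
    (fun x hx => by
      have hxc : 0 < x - c := by linarith [hx.1]
      have hxr : x - c < r := by linarith [hx.2]
      have h3 : a x < η * (x - c) := by
        calc a x ≤ A * (x - c) * (x - c) := (haA x).trans_eq (by ring)
          _ < η * (x - c) := by
            refine mul_lt_mul_of_pos_right (lt_trans ?_ hrA) hxc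
            exact mul_lt_mul_of_pos_left hxr hA
      have : a x * (δ * (-1 / (x - c) ^ 2)) + η * (δ * (x - c)⁻¹)
          = δ * (η * (x - c) - a x) / (x - c) ^ 2 := by
        field_simp
        ring
      rw [this]
      exact div_pos (mul_pos hδ (sub_pos.2 h3)) (by positivity))
    (by
      simp only [add_sub_cancel_left]
      linarith)
  simp only [add_sub_cancel_left, hlogρ] at this
  have hmρ : w (c + ρ) ≤ w m := hm ⟨by linarith, by linarith⟩
  have hEδ : δ * E = w m - w (c + r / 2) := by
    simp only [E]
    field_simp
  nlinarith

lemma le_of_pos_Iio (h : NoPerturbedMax a η w) (hη : 0 < η) {K s t : ℝ}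
    (hK : 0 ≤ K) (hw : Continuous w) (hwK : ∀ x y, |w x - w y| ≤ K * |x - y|)
    (ha1 : ∀ x, a x ≤ 1) (hst : s < t) (ha : ∀ x < t, 0 < a x) : w s ≤ w t := by
  by_contra! hlt
  set e : ℝ → ℝ := fun x => exp (-(η / 2) * x)
  have he : ∀ x, HasDerivAt e (-(η / 2) * e x) x := fun x => by
    have := ((hasDerivAt_id x).const_mul (-(η / 2))).exp
    simpa [e, mul_comm] using this
  have hepos : ∀ x, 0 < e x := fun x => exp_pos _
  have hanti : e t < e s := exp_lt_exp.2 (by nlinarith)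
  set δ := (w s - w t) / (2 * (e s - e t))
  have hes : 0 < e s - e t := sub_pos.2 hanti
  have hδ : 0 < δ := div_pos (sub_pos.2 hlt) (by positivity)
  have hδ' : δ * (e s - e t) = (w s - w t) / 2 := by
    simp only [δ]
    field_simp
  have hec : Continuous e := continuous_iff_continuousAt.2 fun x => (he x).continuousAt
  have key : ∀ y < s, δ * (e y - e s) ≤ w y - w s := by
    intro y hy
    have := h.le_add (y := y) (s := s) (t := t) (Γ := fun x => -δ * e x)
      (g := fun x => -δ * (-(η / 2) * e x)) (g' := fun x => -δ * (-(η / 2) * (-(η / 2) * e x)))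
      hw hy hst (fun x hx => ha x hx.2) (by fun_prop) (fun x _ => (he x).const_mul _)
      (fun x _ => ((he x).const_mul _).const_mul _)
      (fun x _ => by
        have := hepos x
        have : 0 < δ * (η / 2 * e x) := by positivity
        linarith)
      (fun x hx => by
        have := hepos x
        have h1 : 0 < δ * (η / 2) * e x * (η / 2) := by positivity
        have h2 : a x * (δ * (η / 2) * e x * (η / 2)) ≤ 1 * (δ * (η / 2) * e x * (η / 2)) :=
          mul_le_mul_of_nonneg_right (ha1 x) h1.le
        nlinarith)
      (by linarith)
    linarith
  set C := δ * e s
  have hC : 0 < C := mul_pos hδ (hepos s)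
  have hy := key (s - (4 * K / (η * C) + 1) * (2 / η)) (by
    have : 0 < (4 * K / (η * C) + 1) * (2 / η) := by positivity
    linarith)
  set z := 4 * K / (η * C) + 1 with hz
  have hzpos : 0 < z := by positivity
  have hez : e (s - z * (2 / η)) = e s * exp z := by
    simp only [e]
    rw [← exp_add]
    congr 1
    field_simp
    ring
  have hKz := (le_abs_self _).trans (hwK (s - z * (2 / η)) s)
  rw [show s - z * (2 / η) - s = -(z * (2 / η)) by ring, abs_neg, abs_of_pos (by positivity)] at hKz
  rw [hez] at hy
  have hq := quadratic_le_exp_of_nonneg hzpos.le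
  have h1 : C * (z + z ^ 2 / 2) ≤ K * (z * (2 / η)) := by
    refine le_trans ?_ (hy.trans hKz)
    calc C * (z + z ^ 2 / 2) ≤ C * (exp z - 1) := by gcongr; linarith
      _ = δ * (e s * exp z - e s) := by simp only [C]; ring
  have h2 : K * (z * (2 / η)) = C * z * (z - 1) / 2 := by
    rw [hz]
    field_simp
    ring
  rw [h2] at h1
  nlinarith [mul_pos hC hzpos]

lemma le_of_pos_Icc (h : NoPerturbedMax a η w) (hη : 0 < η) {A K s t : ℝ} (hA : 0 < A)
    (hK : 0 ≤ K) (hw : Continuous w) (hwK : ∀ x y, |w x - w y| ≤ K * |x - y|)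
    (hac : Continuous a) (ha01 : ∀ x, a x ∈ Icc (0 : ℝ) 1)
    (haA : ∀ c, a c = 0 → ∀ x, a x ≤ A * (x - c) ^ 2) (hst : s < t)
    (ha : ∀ x ∈ Ico s t, 0 < a x) : w s ≤ w t := by
  by_cases hz : ∃ z ≤ s, a z = 0
  · set Z := {z | z ≤ s ∧ a z = 0}
    have hZc : IsClosed Z := isClosed_Iic.inter (isClosed_eq hac continuous_const)
    have hZb : BddAbove Z := ⟨s, fun z hz => hz.1⟩
    have hmem : sSup Z ∈ Z := hZc.csSup_mem hz hZb
    refine h.le_of_zero hη hw hA (haA _ hmem.2)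
      (lt_of_le_of_ne hmem.1 fun he => ?_) hst fun x hx => ?_
    · exact (ha s ⟨le_rfl, hst⟩).ne' (he ▸ hmem.2)
    · rcases lt_or_ge x s with hxs | hxs
      · refine lt_of_le_of_ne (ha01 x).1 fun he => ?_
        exact hx.1.not_ge (le_csSup hZb ⟨hxs.le, he.symm⟩)
      · exact ha x ⟨hxs, hx.2⟩
  · push Not at hz
    refine h.le_of_pos_Iio hη hK hw hwK (fun x => (ha01 x).2) hst fun x hx => ?_
    rcases le_or_gt x s with hxs | hxs
    · exact lt_of_le_of_ne (ha01 x).1 (hz x hxs).symm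
    · exact ha x ⟨hxs.le, hx⟩

lemma hasDerivAt_zero (h : NoPerturbedMax a η w) (h' : NoPerturbedMax a η fun x => -w x)
    (hη : 0 < η) {A K x : ℝ} (hA : 0 < A)
    (hK : 0 ≤ K) (hw : Continuous w) (hwK : ∀ x y, |w x - w y| ≤ K * |x - y|)
    (hac : Continuous a) (ha01 : ∀ x, a x ∈ Icc (0 : ℝ) 1)
    (haA : ∀ c, a c = 0 → ∀ x, a x ≤ A * (x - c) ^ 2) (hx : 0 < a x) : HasDerivAt w 0 x := by
  obtain ⟨r, hr, hpos⟩ := Metric.eventually_nhds_iff_ball.1 (hac.continuousAt.eventually_const_lt hx)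
  have hconst : ∀ s t, s ∈ Metric.ball x r → t ∈ Metric.ball x r → s < t → w s = w t := by
    intro s t hs ht hst
    have hpos' : ∀ y ∈ Ico s t, 0 < a y := fun y hy => by
      rw [Real.ball_eq_Ioo] at hs ht hpos
      exact hpos y ⟨hs.1.trans_le hy.1, hy.2.trans ht.2⟩
    refine le_antisymm (h.le_of_pos_Icc hη hA hK hw hwK hac ha01 haA hst hpos') ?_
    refine neg_le_neg_iff.1 (h'.le_of_pos_Icc hη hA hK hw.neg (fun x y => ?_) hac ha01 haA hst
      hpos')
    rw [neg_sub_neg, abs_sub_comm]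
    exact hwK x y
  refine (hasDerivAt_const x (w x)).congr_of_eventuallyEq ?_
  filter_upwards [Metric.ball_mem_nhds x hr] with y hy
  rcases lt_trichotomy y x with hyx | rfl | hyx
  · exact hconst y x hy (Metric.mem_ball_self hr) hyx
  · rfl
  · exact (hconst x y (Metric.mem_ball_self hr) hy hyx).symm

end NoPerturbedMax

end Comparison

section Difference

open Filter Topology

variable {a V G u v p : ℝ → ℝ} {β lam η : ℝ}

lemma LipschitzWith.monotone_of_ae_deriv_nonneg {K : NNReal} (hu : LipschitzWith K u)
    (h : ∀ᵐ x, 0 ≤ deriv u x) : Monotone u := by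
  intro x y hxy
  rw [← sub_nonneg, ← (hu.lipschitzOnWith (s := uIcc x y)).absolutelyContinuousOnInterval
    |>.integral_deriv_eq_sub]
  exact intervalIntegral.integral_nonneg_of_ae hxy h

lemma LipschitzWith.eq_of_ae_hasDerivAt_zero {K : NNReal} (hu : LipschitzWith K u)
    (h : ∀ᵐ x, HasDerivAt u 0 x) (x y : ℝ) : u x = u y := by
  obtain ⟨C, hC⟩ := (hu.lipschitzOnWith (s := uIcc x y)).absolutelyContinuousOnInterval
    |>.const_of_ae_hasDerivAt_zero (h.mono fun z hz _ => hz)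
  rw [hC x left_mem_uIcc, hC y right_mem_uIcc]

lemma noPerturbedMax_sub (hu : IsViscSubsol a V G β lam u) (hmono : Monotone u)
    (hG : StrictIncrRate G η)
    (hv : ∀ x, HasDerivAt v (p x) x)
    (hp : ∀ x, a x ≠ 0 → ∃ p', HasDerivAt p p' x ∧ a x * p' + G (p x) + β * V x = lam) :
    NoPerturbedMax a η fun x => u x - v x := by
  intro x Γ g g' hax hΓ hg hgpos hineq hmax
  obtain ⟨p', hp', he⟩ := hp x hax.ne'
  have hW : ∀ᶠ y in 𝓝 x, HasDerivAt (fun y => v y - Γ y) (p y - g y) y :=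
    hΓ.mono fun y hy => (hv y).sub hy
  have hmax' : IsLocalMax (fun y => u y - (v y - Γ y)) x :=
    hmax.congr (Eventually.of_forall fun y => by ring)
  have htest := hu.le_of_isLocalMax hW (hp'.sub hg) hmax'
  have hnonneg : 0 ≤ p x - g x := by
    have hs := (hasDerivWithinAt_iff_tendsto_slope' (self_notMem_Ioi)).1
      (hW.self_of_nhds.hasDerivWithinAt (s := Ioi x))
    refine ge_of_tendsto hs ?_
    filter_upwards [self_mem_nhdsWithin, nhdsWithin_le_nhds hmax'] with y hy hym
    have hxy : x < y := hy
    have := hmono hxy.le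
    have hym' : u y - (v y - Γ y) ≤ u x - (v x - Γ x) := hym
    rw [slope_def_field]
    exact div_nonneg (by linarith) (by linarith)
  have := (hG (p x - g x) (p x) hnonneg (by linarith)).1
  nlinarith

lemma noPerturbedMax_neg_sub (hu : IsViscSupersol a V G β lam u)
    (hG : StrictIncrRate G η)
    (hv : ∀ x, HasDerivAt v (p x) x) (hp0 : ∀ x, 0 ≤ p x)
    (hp : ∀ x, a x ≠ 0 → ∃ p', HasDerivAt p p' x ∧ a x * p' + G (p x) + β * V x = lam) :
    NoPerturbedMax a η fun x => -(u x - v x) := by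
  intro x Γ g g' hax hΓ hg hgpos hineq hmax
  obtain ⟨p', hp', he⟩ := hp x hax.ne'
  have hW : ∀ᶠ y in 𝓝 x, HasDerivAt (fun y => -(v y + Γ y)) (-(p y + g y)) y :=
    hΓ.mono fun y hy => ((hv y).add hy).neg
  have hmax' : IsLocalMax (fun y => -u y - -(v y + Γ y)) x :=
    hmax.congr (Eventually.of_forall fun y => by ring)
  have htest := (isViscSubsol_neg_iff.2 hu).le_of_isLocalMax hW (hp'.add hg).neg hmax'
  simp only [neg_neg] at htest
  have := (hG (p x) (p x + g x) (hp0 x) (by linarith)).1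
  nlinarith

end Difference

section GrowthClass

open Filter Topology

variable {G : ℝ → ℝ}

lemma MemGclass.exists_lipschitz_bound (hG : MemGclass G) (R : ℝ) :
    ∃ k : ℝ, 0 ≤ k ∧ ∀ p q, |p| ≤ R → |q| ≤ R → |G p - G q| ≤ k * |p - q| := by
  obtain ⟨α₀, α₁, γ, -, hα₁, hγ, -, h⟩ := hG
  rcases lt_or_ge R 0 with hR | hR
  · exact ⟨0, le_rfl, fun p q hp _ => absurd (hp.trans_lt hR) (abs_nonneg p).not_gt⟩
  refine ⟨α₁ * (R + R + 1) ^ (γ - 1), by positivity, fun p q hp hq => (h p q).trans ?_⟩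
  have : 0 ≤ γ - 1 := by linarith
  gcongr

lemma MemGclass.continuous (hG : MemGclass G) : Continuous G := by
  refine continuous_iff_continuousAt.2 fun x => ?_
  obtain ⟨k, hk, h⟩ := hG.exists_lipschitz_bound (|x| + 1)
  have hL : LipschitzOnWith k.toNNReal G (Icc (-(|x| + 1)) (|x| + 1)) :=
    LipschitzOnWith.of_dist_le_mul fun p hp q hq => by
      rw [Real.coe_toNNReal _ hk]
      exact h p q (abs_le.2 hp) (abs_le.2 hq)
  refine hL.continuousOn.continuousAt (Icc_mem_nhds ?_ ?_)
  · linarith [neg_abs_le x]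
  · linarith [le_abs_self x]

lemma MemGsqc.comp_neg (hG : MemGsqc G) : MemGsqc fun p => G (-p) := by
  obtain ⟨⟨α₀, α₁, γ, h₀, h₁, hγ, hb, hl⟩, hz, η, hη, hi⟩ := hG
  refine ⟨⟨α₀, α₁, γ, h₀, h₁, hγ, fun p => ?_, fun p q => ?_⟩, by simpa using hz, η, hη,
    fun p q hp hpq => ?_⟩
  · simpa using hb (-p)
  · have := hl (-p) (-q)
    rwa [abs_neg, abs_neg, neg_sub_neg, abs_sub_comm q] at this
  · have := hi p q hp hpq
    simp only [neg_neg]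
    exact ⟨this.2, this.1⟩

lemma MemGsqc.gplusInv_spec (hG : MemGsqc G) {y : ℝ} (hy : 0 ≤ y) :
    0 ≤ GplusInv G y ∧ G (GplusInv G y) = y := by
  obtain ⟨hcl, hz, η, hη, hi⟩ := hG
  have hex : ∃ p ∈ Ici (0 : ℝ), G p = y := by
    have hyη : 0 ≤ y / η := div_nonneg hy hη.le
    have hle : y ≤ G (y / η) := by
      rcases eq_or_lt_of_le hyη with h0 | hpos
      · rw [← h0, hz]
        have : y = y / η * η := by field_simp
        rw [this, ← h0, zero_mul]
      · have := (hi 0 (y / η) le_rfl hpos).1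
        rw [hz, sub_zero, sub_zero, mul_div_cancel₀ _ hη.ne'] at this
        exact this
    obtain ⟨p, hp, hpy⟩ := intermediate_value_Icc hyη hcl.continuous.continuousOn
      ⟨by rw [hz]; exact hy, hle⟩
    exact ⟨p, hp.1, hpy⟩
  exact ⟨Function.invFunOn_mem hex, Function.invFunOn_eq hex⟩

lemma StrictIncrRate.strictMonoOn {η : ℝ} (hG : StrictIncrRate G η) (hη : 0 < η) :
    StrictMonoOn G (Ici 0) := fun p hp q _ hpq => by
  have := (hG p q hp hpq).1
  nlinarith [mul_pos hη (sub_pos.2 hpq)]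

lemma MemGsqc.gminusInv_eq (hG : MemGsqc G) {y : ℝ} (hy : 0 ≤ y) :
    GminusInv G y = -GplusInv (fun p => G (-p)) y := by
  obtain ⟨h1, h2⟩ := hG.comp_neg.gplusInv_spec hy
  have hex : ∃ p ∈ Iic (0 : ℝ), G p = y :=
    ⟨-GplusInv (fun p => G (-p)) y, neg_nonpos.2 h1, h2⟩
  have h3 : GminusInv G y ∈ Iic 0 := Function.invFunOn_mem hex
  have h4 : G (GminusInv G y) = y := Function.invFunOn_eq hex
  obtain ⟨-, -, η, hη, hi⟩ := hG.comp_neg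
  have h3' : -GminusInv G y ∈ Ici (0 : ℝ) := mem_Ici.2 (neg_nonneg.2 (mem_Iic.1 h3))
  have h5 : G (- -GminusInv G y) = G (-GplusInv (fun p => G (-p)) y) := by
    rw [neg_neg, h4]
    exact h2.symm
  have := (hi.strictMonoOn hη).injOn h3' h1 h5
  linarith

end GrowthClass

section Reflection

open Filter Topology

variable {a V G u : ℝ → ℝ} {β lam : ℝ}

lemma IsViscSubsol.comp_neg (h : IsViscSubsol a V G β lam u) :
    IsViscSubsol (fun x => a (-x)) (fun x => V (-x)) (fun p => G (-p)) β lam fun x => u (-x) := by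
  intro x φ hφ hmax
  have hφ' : ContDiff ℝ 2 fun y => φ (-y) := hφ.comp contDiff_neg
  have hmax' : IsLocalMax (fun y => u y - φ (-y)) (-x) := by
    have hc : Tendsto (fun y : ℝ => -y) (𝓝 (-x)) (𝓝 x) := by
      simpa using (continuous_neg (G := ℝ)).tendsto (-x)
    filter_upwards [hc.eventually hmax] with y hy
    simpa using hy
  have hd : deriv (fun y => φ (-y)) = fun y => -deriv φ (-y) :=
    funext fun y => deriv_comp_neg φ y
  have hd2 : deriv (fun y => -deriv φ (-y)) (-x) = deriv (deriv φ) x := by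
    rw [deriv.fun_neg, deriv_comp_neg, neg_neg, neg_neg]
  have := h (-x) _ hφ' hmax'
  rw [hd, hd2] at this
  simpa using this

lemma IsViscSupersol.comp_neg (h : IsViscSupersol a V G β lam u) :
    IsViscSupersol (fun x => a (-x)) (fun x => V (-x)) (fun p => G (-p)) β lam
      fun x => u (-x) :=
  isViscSubsol_neg_iff.1 (isViscSubsol_neg_iff.2 h).comp_neg

lemma IsViscSol.comp_neg (h : IsViscSol a V G β lam u) :
    IsViscSol (fun x => a (-x)) (fun x => V (-x)) (fun p => G (-p)) β lam fun x => u (-x) :=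
  ⟨h.1.comp continuous_neg, h.2.1.comp_neg, h.2.2.comp_neg⟩

lemma ae_comp_neg {P : ℝ → Prop} (h : ∀ᵐ x, P x) : ∀ᵐ x, P (-x) :=
  (Measure.measurePreserving_neg (volume : Measure ℝ)).quasiMeasurePreserving.ae h

lemma comp_neg_mem_splus (hG : MemGsqc G) (hβ : 0 ≤ β) (hlam : β ≤ lam)
    (hu : u ∈ Sminus a V G β lam) :
    (fun x => u (-x)) ∈
      Splus (fun x => a (-x)) (fun x => V (-x)) (fun p => G (-p)) β lam := by
  obtain ⟨⟨K, hK⟩, hsol, hae⟩ := hu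
  refine ⟨⟨K, by simpa using! hK.comp (LipschitzWith.id.neg)⟩, hsol.comp_neg, ?_⟩
  filter_upwards [ae_comp_neg hae] with x hx
  rw [hG.gminusInv_eq (hβ.trans hlam), hG.gminusInv_eq (sub_nonneg.2 hlam)] at hx
  rw [deriv_comp_neg]
  exact ⟨le_neg_of_le_neg hx.2, neg_le.1 hx.1⟩

lemma comp_neg_mem_sminus (hG : MemGsqc G) (hβ : 0 ≤ β) (hlam : β ≤ lam)
    (hu : u ∈ Splus (fun x => a (-x)) (fun x => V (-x)) (fun p => G (-p)) β lam) :
    (fun x => u (-x)) ∈ Sminus a V G β lam := by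
  obtain ⟨⟨K, hK⟩, hsol, hae⟩ := hu
  refine ⟨⟨K, by simpa using! hK.comp (LipschitzWith.id.neg)⟩, by simpa using hsol.comp_neg, ?_⟩
  filter_upwards [ae_comp_neg hae] with x hx
  rw [hG.gminusInv_eq (hβ.trans hlam), hG.gminusInv_eq (sub_nonneg.2 hlam), deriv_comp_neg]
  exact ⟨neg_le_neg hx.2, neg_le_neg hx.1⟩

end Reflection

section Main

variable {a V G : ℝ → ℝ} {β lam κ : ℝ}

lemma le_sq_of_sqrt_lipschitz (hκ : 0 < κ) (ha : ∀ x, 0 ≤ a x)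
    (ha_lip : LipschitzWith (Real.toNNReal κ) (fun x => Real.sqrt (a x))) {c : ℝ} (hc : a c = 0)
    (x : ℝ) : a x ≤ κ ^ 2 * (x - c) ^ 2 := by
  have h := ha_lip.dist_le_mul x c
  rw [Real.coe_toNNReal _ hκ.le, hc, Real.sqrt_zero, Real.dist_eq, Real.dist_eq, sub_zero,
    abs_of_nonneg (Real.sqrt_nonneg _)] at h
  calc a x = Real.sqrt (a x) ^ 2 := (Real.sq_sqrt (ha x)).symm
    _ ≤ (κ * |x - c|) ^ 2 := by gcongr
    _ = κ ^ 2 * (x - c) ^ 2 := by rw [mul_pow, sq_abs]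

lemma lipschitzWith_of_sqrt_lipschitz (ha : ∀ x, a x ∈ Icc (0 : ℝ) 1)
    (ha_lip : LipschitzWith (Real.toNNReal κ) (fun x => Real.sqrt (a x))) :
    LipschitzWith (2 * Real.toNNReal κ) a := by
  refine LipschitzWith.of_dist_le_mul fun x y => ?_
  have h := ha_lip.dist_le_mul x y
  rw [Real.dist_eq] at h ⊢
  have hx1 : Real.sqrt (a x) ≤ 1 := Real.sqrt_le_one.2 (ha x).2
  have hy1 : Real.sqrt (a y) ≤ 1 := Real.sqrt_le_one.2 (ha y).2
  have he : a x - a y = (Real.sqrt (a x) + Real.sqrt (a y)) * (Real.sqrt (a x) - Real.sqrt (a y)) := by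
    nlinarith [Real.sq_sqrt (ha x).1, Real.sq_sqrt (ha y).1]
  rw [he, abs_mul, abs_of_nonneg (by positivity)]
  push_cast
  rw [mul_assoc]
  exact mul_le_mul (by linarith) h (abs_nonneg _) (by norm_num)

/-- Existence of a solution in `Splus` vanishing at `0`, together with its continuous derivative. -/
lemma exists_mem_splus (hβ : 0 ≤ β) (hlam : β ≤ lam)
    (ha_range : ∀ x, a x ∈ Set.Icc (0 : ℝ) 1)
    (ha_lip : LipschitzWith (Real.toNNReal κ) (fun x => Real.sqrt (a x)))
    (hV_range : ∀ x, V x ∈ Set.Icc (0 : ℝ) 1) (hV : Continuous V) (hG : MemGsqc G) :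
    ∃ v p : ℝ → ℝ, v ∈ Splus a V G β lam ∧ v 0 = 0 ∧ (∀ x, 0 ≤ p x) ∧
      (∀ x, HasDerivAt v (p x) x) ∧ (∀ x, a x = 0 → G (p x) + β * V x = lam) ∧
      ∀ x, a x ≠ 0 → ∃ p', HasDerivAt p p' x ∧ a x * p' + G (p x) + β * V x = lam := by
  obtain ⟨hl0, hGl⟩ := hG.gplusInv_spec (sub_nonneg.2 hlam)
  obtain ⟨hr0, hGr⟩ := hG.gplusInv_spec (hβ.trans hlam)
  obtain ⟨hcl, -, η, hη, hi⟩ := hG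
  set l := GplusInv G (lam - β)
  set r := GplusInv G lam
  have hlr : l ≤ r := (hi.strictMonoOn hη).le_iff_le hl0 hr0 |>.1 (by rw [hGl, hGr]; linarith)
  obtain ⟨k, hk, hLip⟩ := hcl.exists_lipschitz_bound r
  have hslope : SlopeBounds G η (k + η) l r := by
    intro p q hp hpq hq
    have hp0 : 0 ≤ p := hl0.trans hp
    constructor
    · rcases eq_or_lt_of_le hpq with rfl | hlt
      · simp
      · exact (hi p q hp0 hlt).1
    · have := (le_abs_self _).trans (hLip q p
        (by rw [abs_of_nonneg (hp0.trans hpq)]; exact hq)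
        (by rw [abs_of_nonneg hp0]; exact hpq.trans hq))
      rw [abs_of_nonneg (sub_nonneg.2 hpq)] at this
      nlinarith [mul_nonneg hη.le (sub_nonneg.2 hpq)]
  obtain ⟨p, hpc, hpm, hp0, hp1⟩ := exists_profile (f := fun x => lam - β * V x)
    (lipschitzWith_of_sqrt_lipschitz ha_range ha_lip) ha_range (by fun_prop)
    (fun x => by nlinarith [(hV_range x).2]) (fun x => by nlinarith [(hV_range x).1])
    hη (by linarith) hlr hslope
  have hv : ∀ x, HasDerivAt (fun x => ∫ t in (0 : ℝ)..x, p t) (p x) x := fun x =>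
    (hpc.integral_hasStrictDerivAt 0 x).hasDerivAt
  have h0 : ∀ x, a x = 0 → G (p x) + β * V x = lam := fun x hx => by linarith [hp0 x hx]
  have h1 : ∀ x, a x ≠ 0 → ∃ p', HasDerivAt p p' x ∧ a x * p' + G (p x) + β * V x = lam :=
    fun x hx => ⟨_, hp1 x hx, by field_simp; ring⟩
  have hpnn : ∀ x, 0 ≤ p x := fun x => hl0.trans (hpm x).1
  refine ⟨_, p, ⟨⟨r.toNNReal, ?_⟩, isViscSol_of_hasDerivAt (fun x => (ha_range x).1) hv h0 h1, ?_⟩,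
    by simp, hpnn, hv, h0, h1⟩
  · refine lipschitzWith_of_nnnorm_deriv_le (fun x => (hv x).differentiableAt) fun x => ?_
    rw [← NNReal.coe_le_coe, coe_nnnorm, (hv x).deriv, Real.coe_toNNReal _ hr0, Real.norm_eq_abs,
      abs_of_nonneg (hpnn x)]
    exact (hpm x).2
  · refine ae_of_all _ fun x => ?_
    rw [(hv x).deriv]
    exact hpm x

lemma existsUnique_mem_splus (hβ : 0 ≤ β) (hlam : β ≤ lam) (hκ : 0 < κ)
    (ha_range : ∀ x, a x ∈ Set.Icc (0 : ℝ) 1)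
    (ha_lip : LipschitzWith (Real.toNNReal κ) (fun x => Real.sqrt (a x)))
    (hV_range : ∀ x, V x ∈ Set.Icc (0 : ℝ) 1) (hV : Continuous V) (hG : MemGsqc G) :
    ∃! u : ℝ → ℝ, u ∈ Splus a V G β lam ∧ u 0 = 0 := by
  obtain ⟨v, p, hvS, hv0, hpnn, hv, hp0, hp1⟩ :=
    exists_mem_splus hβ hlam ha_range ha_lip hV_range hV hG
  refine ⟨v, ⟨hvS, hv0⟩, fun u hu => ?_⟩
  obtain ⟨⟨⟨K, hK⟩, hsol, hae⟩, hu0⟩ := hu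
  obtain ⟨⟨K', hK'⟩, -, -⟩ := hvS
  have hl0 := (hG.gplusInv_spec (sub_nonneg.2 hlam)).1
  obtain ⟨hcl, -, η, hη, hi⟩ := hG
  have haL := lipschitzWith_of_sqrt_lipschitz ha_range ha_lip
  have hmono : Monotone u := hK.monotone_of_ae_deriv_nonneg (hae.mono fun x hx => hl0.trans hx.1)
  have hw : LipschitzWith (K + K') fun x => u x - v x := hK.sub hK'
  have hmax1 := noPerturbedMax_sub hsol.2.1 hmono hi hv hp1
  have hmax2 := noPerturbedMax_neg_sub hsol.2.2 hi hv hpnn hp1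
  have hd : ∀ᵐ x, HasDerivAt (fun x => u x - v x) 0 x := by
    filter_upwards [hae, hK.ae_differentiableAt_real] with x hx hdx
    rcases eq_or_lt_of_le (ha_range x).1 with hax | hax
    · have h1 := hsol.eq_of_hasDerivAt (L := (2 * Real.toNNReal κ : NNReal)) (c := x)
        hcl.continuous hV (fun y => by
          have := haL.dist_le_mul y x
          rw [Real.dist_eq, ← hax, sub_zero, Real.dist_eq] at this
          exact (le_abs_self _).trans this) hdx.hasDerivAt
      have h2 : deriv u x = p x := (hi.strictMonoOn hη).injOn (hl0.trans hx.1) (hpnn x)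
        (by linarith [hp0 x hax.symm])
      have := hdx.hasDerivAt.sub (hv x)
      rwa [h2, sub_self] at this
    · exact hmax1.hasDerivAt_zero hmax2 hη (A := κ ^ 2) (K := (K + K' : NNReal)) (by positivity)
        (NNReal.coe_nonneg _) hw.continuous (fun x y => hw.dist_le_mul x y) haL.continuous ha_range
        (fun c hc x => le_sq_of_sqrt_lipschitz hκ (fun x => (ha_range x).1) ha_lip hc x) hax
  ext x
  have := hw.eq_of_ae_hasDerivAt_zero hd x 0
  rw [hu0, hv0] at this
  linarith

end Main

theorem existence_uniqueness_of_normalized_correctors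
    (β lam κ : ℝ) (hβ : 0 ≤ β) (hlam : β ≤ lam) (hκ : 0 < κ)
    (a V G : ℝ → ℝ)
    (ha_range : ∀ x, a x ∈ Set.Icc (0 : ℝ) 1)
    (ha_lip : LipschitzWith (Real.toNNReal κ) (fun x => Real.sqrt (a x)))
    (hV_range : ∀ x, V x ∈ Set.Icc (0 : ℝ) 1)
    (hV_lip : LipschitzWith (Real.toNNReal κ) V)
    (hG : MemGsqc G) :
    (∃! u : ℝ → ℝ, u ∈ Splus a V G β lam ∧ u 0 = 0) ∧
    (∃! u : ℝ → ℝ, u ∈ Sminus a V G β lam ∧ u 0 = 0) := by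
  refine ⟨existsUnique_mem_splus hβ hlam hκ ha_range ha_lip hV_range hV_lip.continuous hG, ?_⟩
  obtain ⟨u, ⟨hu, hu0⟩, huniq⟩ := existsUnique_mem_splus (a := fun x => a (-x))
    (V := fun x => V (-x)) hβ hlam hκ (fun x => ha_range (-x))
    (by simpa using! ha_lip.comp LipschitzWith.id.neg) (fun x => hV_range (-x))
    (hV_lip.continuous.comp continuous_neg) hG.comp_neg
  refine ⟨fun x => u (-x), ⟨comp_neg_mem_sminus hG hβ hlam hu, by simpa using hu0⟩, ?_⟩
  intro w hw
  have := huniq (fun x => w (-x)) ⟨comp_neg_mem_splus hG hβ hlam hw.1, by simpa using hw.2⟩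
  rw [← this]
  simp
end
end
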